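/- There exist universal constants $\lambda, C > 0$ such that $\sup_{\varepsilon \in (0,1)} \big( \mathbb{E}_{\mathbf{B}}[e^{\lambda X_\varepsilon}] + \mathbb{E}_{\mathbf{B}}[e^{\lambda Y_\varepsilon}] \big) \le C$. -/

import Mathlib

open MeasureTheory ProbabilityTheory Real Filter Set

/-- The standard Gaussian-type measure on `ι → ℝ` with covariance `v · Id`:
the product over coordinates of the real Gaussian `N(0, v)`. -/
noncomputable def gaussianPi (ι : Type*) [Fintype ι] (v : NNReal) : Measure (ι → ℝ) :=
  Measure.pi fun _ => gaussianReal 0 v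

/-- A standard Brownian motion with values in `ι → ℝ` (time parameter in `[0,∞)`,
the process being given on all of `ℝ` with the defining properties imposed at
nonnegative times): it starts at the origin, has continuous paths, independent
increments, and Gaussian increments `B_t - B_s ~ N(0, (t-s)·Id)` for `0 ≤ s ≤ t`. -/
structure IsStdBM {Ω : Type*} [MeasurableSpace Ω] (P : Measure Ω)
    {ι : Type*} [Fintype ι] (B : ℝ → Ω → ι → ℝ) : Prop where
  isProb : IsProbabilityMeasure P
  init : ∀ ω, B 0 ω = 0
  cont : ∀ ω i, Continuous fun t => B t ω i
  meas : ∀ t, Measurable (B t)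
  indep_incr : ∀ (n : ℕ) (t : Fin (n + 1) → ℝ), (∀ i, 0 ≤ t i) → Monotone t →
    iIndepFun
      (fun k : Fin n => fun ω => B (t k.succ) ω - B (t k.castSucc) ω) P
  gauss_incr : ∀ s t : ℝ, 0 ≤ s → s ≤ t →
    P.map (fun ω => B t ω - B s ω) = gaussianPi ι (t - s).toNNReal

/-- The `k`-th planar component of a Brownian motion indexed by `κ × Fin 2`;
a standard BM in `(κ × Fin 2) → ℝ` is precisely a family of independent standard
planar Brownian motions indexed by `κ`. -/
def planarComp {Ω κ : Type*} (W : ℝ → Ω → κ × Fin 2 → ℝ) (k : κ) :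
    ℝ → Ω → Fin 2 → ℝ :=
  fun t ω i => W t ω (k, i)

/-- The rescaling `R_ε(x) = ε⁻² R(x/ε)` of a function `R : ℝ² → ℝ`. -/
noncomputable def mollify (R : (Fin 2 → ℝ) → ℝ) (ε : ℝ) (x : Fin 2 → ℝ) : ℝ :=
  (ε ^ 2)⁻¹ * R (ε⁻¹ • x)

/-- `β_ε(A) = ∫_A R_ε(B_s - B_u) du ds` for a single process `B`,
where the integration variable is `p = (u, s) ∈ A ⊆ ℝ₊²`. -/
noncomputable def betaSet (R : (Fin 2 → ℝ) → ℝ) (ε : ℝ) {Ω : Type*}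
    (B : ℝ → Ω → Fin 2 → ℝ) (A : Set (ℝ × ℝ)) (ω : Ω) : ℝ :=
  ∫ p in A, mollify R ε (B p.2 ω - B p.1 ω)

/-- `α_ε(A) = ∫_A R_ε(B¹_s - B²_u) du ds` for two processes `B¹, B²`,
where the integration variable is `p = (u, s) ∈ A ⊆ ℝ₊²`. -/
noncomputable def alphaSet (R : (Fin 2 → ℝ) → ℝ) (ε : ℝ) {Ω : Type*}
    (B₁ B₂ : ℝ → Ω → Fin 2 → ℝ) (A : Set (ℝ × ℝ)) (ω : Ω) : ℝ :=
  ∫ p in A, mollify R ε (B₁ p.2 ω - B₂ p.1 ω)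

/-- The triangle `[0,t]²_< = {(u,s) : 0 ≤ u < s ≤ t}`. -/
def ltSet (t : ℝ) : Set (ℝ × ℝ) := {p : ℝ × ℝ | 0 ≤ p.1 ∧ p.1 < p.2 ∧ p.2 ≤ t}

theorem lint_pi {n : ℕ} {E : Type*} [MeasurableSpace E] (μ : Fin n → Measure E)
    [∀ i, SigmaFinite (μ i)] (f : Fin n → E → ENNReal) (hf : ∀ i, Measurable (f i)) :
    ∫⁻ x, ∏ i, f i (x i) ∂(Measure.pi μ) = ∏ i, ∫⁻ x, f i x ∂(μ i) := by
  induction n with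
  | zero => simp
  | succ n ih =>
    have h := (measurePreserving_piFinSuccAbove μ 0).symm
    rw [← h.lintegral_comp_emb (MeasurableEquiv.measurableEmbedding _)]
    simp only [Fin.prod_univ_succ]
    rw [lintegral_prod]
    · simp only [MeasurableEquiv.piFinSuccAbove_symm_apply, Fin.insertNthEquiv_zero, Fin.consEquiv_apply, Fin.cons_zero, Fin.cons_succ]
      rw [← ih (fun i => μ i.succ) (fun i => f i.succ) (fun i => hf _)]
      rw [← lintegral_mul_const _ (hf 0)]
      congr 1; ext x
      rw [lintegral_const_mul]
      · rfl
      · exact Finset.measurable_prod _ fun i _ => (hf _).comp (measurable_pi_apply i)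
    · apply Measurable.aemeasurable
      apply Measurable.mul
      · exact (hf 0).comp ((measurable_pi_apply 0).comp (MeasurableEquiv.measurable _))
      · exact Finset.measurable_prod _ fun i _ => (hf _).comp ((measurable_pi_apply _).comp (MeasurableEquiv.measurable _))

def HasL2 {E : Type*} [MeasureSpace E] (μ : Measure E) (c : ENNReal) : Prop :=
  ∃ p : E → ENNReal, Measurable p ∧ μ = volume.withDensity p ∧ ∫⁻ x, p x ^ 2 ≤ c

theorem HasL2.pi {n : ℕ} {E : Type*} [MeasureSpace E] [SigmaFinite (volume : Measure E)]
    (μ : Fin n → Measure E) [∀ i, IsProbabilityMeasure (μ i)] (c : Fin n → ENNReal)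
    (h : ∀ i, HasL2 (μ i) (c i)) : HasL2 (Measure.pi μ) (∏ i, c i) := by
  choose p hp hμ hc using h
  refine ⟨fun x => ∏ i, p i (x i), ?_, ?_, ?_⟩
  · exact Finset.measurable_prod _ fun i _ => (hp _).comp (measurable_pi_apply i)
  · refine Measure.pi_eq fun s hs => ?_
    rw [withDensity_apply _ (MeasurableSet.univ_pi hs), volume_pi, Measure.restrict_pi_pi,
      lint_pi _ _ hp]
    refine Finset.prod_congr rfl fun i _ => ?_
    conv_rhs => rw [hμ i]
    rw [withDensity_apply _ (hs i)]
  · simp only [← Finset.prod_pow]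
    rw [volume_pi, lint_pi _ (fun i x => p i x ^ 2) (fun i => (hp i).pow_const 2)]
    exact Finset.prod_le_prod' fun i _ => hc i

theorem HasL2.map {E F : Type*} [MeasureSpace E] [MeasureSpace F] {μ : Measure E} {c : ENNReal}
    (h : HasL2 μ c) (e : E ≃ᵐ F) (he : MeasurePreserving e volume volume) :
    HasL2 (μ.map e) c := by
  obtain ⟨p, hp, rfl, hc⟩ := h
  refine ⟨p ∘ e.symm, hp.comp e.symm.measurable, ?_, ?_⟩
  · ext s hs
    rw [Measure.map_apply e.measurable hs, withDensity_apply _ (e.measurable hs),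
      withDensity_apply _ hs, ← he.setLIntegral_comp_preimage_emb e.measurableEmbedding]
    simp
  · refine le_trans (le_of_eq ?_) hc
    exact he.symm.lintegral_comp_emb e.symm.measurableEmbedding (fun x => p x ^ 2)

theorem HasL2.conv {E : Type*} [AddCommGroup E] [MeasureSpace E] [MeasurableAdd₂ E] [MeasurableNeg E]
    [MeasurableSub₂ E]
    [SFinite (volume : Measure E)] [(volume : Measure E).IsAddLeftInvariant]
    [(volume : Measure E).IsNegInvariant]
    {μ ν : Measure E} {c d : ENNReal}
    (hμ : HasL2 μ c) (hν : HasL2 ν d) (f : E → ENNReal) (hf : Measurable f) :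
    ∫⁻ z, ∫⁻ w, f (z + w) ∂ν ∂μ ≤ c ^ (1/2 : ℝ) * d ^ (1/2 : ℝ) * ∫⁻ x, f x := by
  obtain ⟨p, hp, rfl, hc⟩ := hμ
  obtain ⟨q, hq, rfl, hd⟩ := hν
  have h1 : ∀ z, ∫⁻ w, f (z + w) ∂(volume.withDensity q) = ∫⁻ y, q (y - z) * f y := by
    intro z
    rw [lintegral_withDensity_eq_lintegral_mul _ hq (by fun_prop)]
    rw [← lintegral_sub_right_eq_self (fun w => (q * fun w => f (z + w)) w) z]
    simp
  simp only [h1]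
  have hm : Measurable fun x : E × E => q (x.2 - x.1) * f x.2 := by fun_prop
  have hm' : ∀ z, Measurable fun y : E => q (y - z) * f y := fun z => by fun_prop
  rw [lintegral_withDensity_eq_lintegral_mul _ hp hm.lintegral_prod_right']
  simp only [Pi.mul_apply]
  have h2 : ∀ z, p z * ∫⁻ y, q (y - z) * f y = ∫⁻ y, p z * (q (y - z) * f y) := fun z =>
    (lintegral_const_mul _ (hm' z)).symm
  simp only [h2]
  rw [lintegral_lintegral_swap (by fun_prop)]
  rw [← lintegral_const_mul _ hf]
  refine lintegral_mono fun y => ?_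
  simp only [← mul_assoc]
  rw [lintegral_mul_const _ (by fun_prop)]
  gcongr
  refine (ENNReal.lintegral_mul_le_Lp_mul_Lq volume (p := 2) (q := 2) ⟨by norm_num, by norm_num, by norm_num⟩ hp.aemeasurable (by fun_prop)).trans ?_
  have : ∫⁻ z, q (y - z) ^ (2:ℝ) = ∫⁻ z, q z ^ (2:ℝ) := lintegral_sub_left_eq_self (fun z => q z ^ (2:ℝ)) y
  rw [this]
  gcongr
  · simpa using hc
  · simpa using hd

theorem hasL2_gauss (v : ℝ) (hv : 0 < v) :
    HasL2 (gaussianReal 0 v.toNNReal) (ENNReal.ofReal (v ^ (-(1/2) : ℝ))) := by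
  have hv' : v.toNNReal ≠ 0 := by simpa using hv
  refine ⟨gaussianPDF 0 v.toNNReal, measurable_gaussianPDF _ _, gaussianReal_of_var_ne_zero _ hv', ?_⟩
  have hb : ∀ x, gaussianPDF 0 v.toNNReal x ≤ ENNReal.ofReal (v ^ (-(1/2) : ℝ)) := by
    intro x
    rw [gaussianPDF]
    apply ENNReal.ofReal_le_ofReal
    rw [gaussianPDFReal]
    have h1 : (√(2 * π * v.toNNReal))⁻¹ ≤ v ^ (-(1/2) : ℝ) := by
      rw [Real.rpow_neg hv.le, ← Real.sqrt_eq_rpow, Real.coe_toNNReal _ hv.le]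
      apply inv_anti₀ (Real.sqrt_pos.2 hv)
      apply Real.sqrt_le_sqrt
      nlinarith [Real.pi_gt_three]
    have h2 : rexp (-(x - 0) ^ 2 / (2 * v.toNNReal)) ≤ 1 := by
      rw [Real.exp_le_one_iff]
      apply div_nonpos_of_nonpos_of_nonneg
      · nlinarith [sq_nonneg (x - 0)]
      · positivity
    calc _ ≤ v ^ (-(1/2) : ℝ) * 1 := by gcongr
      _ = _ := mul_one _
  calc ∫⁻ x, gaussianPDF 0 v.toNNReal x ^ 2
      ≤ ∫⁻ x, ENNReal.ofReal (v ^ (-(1/2) : ℝ)) * gaussianPDF 0 v.toNNReal x := by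
        refine lintegral_mono fun x => ?_
        rw [sq]
        gcongr
        exact hb x
    _ = _ := by
        rw [lintegral_const_mul _ (measurable_gaussianPDF _ _), lintegral_gaussianPDF_eq_one _ hv', mul_one]

theorem hasL2_gaussPi (v : ℝ) (hv : 0 < v) :
    HasL2 (gaussianPi (Fin 2) v.toNNReal) (ENNReal.ofReal (v⁻¹)) := by
  have := HasL2.pi (n := 2) (fun _ => gaussianReal 0 v.toNNReal) _ (fun _ => hasL2_gauss v hv)
  have e : ENNReal.ofReal (v⁻¹) = ∏ i : Fin 2, ENNReal.ofReal (v ^ (-(1/2) : ℝ)) := by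
    simp only [Finset.prod_const, Finset.card_univ, Fintype.card_fin]
    rw [← ENNReal.ofReal_pow (by positivity), ← Real.rpow_natCast, ← Real.rpow_mul hv.le]
    norm_num
    rw [Real.rpow_neg_one]
  rw [e]
  exact this

/-! differences -/

def dif {E : Type*} [AddCommGroup E] {n : ℕ} (z : Fin n → E) (i : Fin n) : E :=
  z i - (Fin.cons 0 z : Fin (n + 1) → E) i.castSucc

theorem cons_partialSum {E : Type*} [AddCommGroup E] {n : ℕ} (x : Fin n → E) :
    (Fin.cons 0 (fun i => Fin.partialSum x i.succ) : Fin (n + 1) → E) = Fin.partialSum x := by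
  ext i
  refine Fin.cases ?_ (fun i => ?_) i <;> simp

theorem partialSum_dif {E : Type*} [AddCommGroup E] {n : ℕ} (z : Fin n → E) :
    Fin.partialSum (dif z) = (Fin.cons 0 z : Fin (n + 1) → E) := by
  ext i
  induction i using Fin.induction with
  | zero => simp
  | succ i ih => rw [Fin.partialSum_succ, ih]; simp [dif]

theorem measurable_dif {E : Type*} [AddCommGroup E] [MeasurableSpace E] [MeasurableSub₂ E] {n : ℕ} :
    Measurable (dif : (Fin n → E) → Fin n → E) := by
  refine measurable_pi_lambda _ fun i => ?_
  apply Measurable.sub (measurable_pi_apply i)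
  generalize i.castSucc = j
  refine Fin.cases ?_ (fun i => ?_) j
  · simp
  · simp only [Fin.cons_succ]; exact measurable_pi_apply i

theorem measurable_psum {E : Type*} [AddCommGroup E] [MeasurableSpace E] [MeasurableAdd₂ E] {n : ℕ}
    (j : Fin (n + 1)) : Measurable (fun x : Fin n → E => Fin.partialSum x j) := by
  induction j using Fin.induction with
  | zero => simp
  | succ i ih => simp only [Fin.partialSum_succ]; exact ih.add (measurable_pi_apply i)

def difEquiv (E : Type*) [AddCommGroup E] [MeasurableSpace E] [MeasurableAdd₂ E] [MeasurableSub₂ E]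
    (n : ℕ) : (Fin n → E) ≃ᵐ (Fin n → E) where
  toFun := dif
  invFun x i := Fin.partialSum x i.succ
  left_inv z := by ext i; simp [partialSum_dif]
  right_inv x := by
    ext i
    simp only [dif]
    rw [cons_partialSum, Fin.partialSum_succ]
    simp
  measurable_toFun := measurable_dif
  measurable_invFun := measurable_pi_lambda _ fun i => measurable_psum _

theorem mp_dif {E : Type*} [AddCommGroup E] [MeasureSpace E] [MeasurableAdd₂ E] [MeasurableSub₂ E]
    [SigmaFinite (volume : Measure E)] [(volume : Measure E).IsAddRightInvariant] (n : ℕ) :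
    MeasurePreserving (dif : (Fin n → E) → Fin n → E) volume volume := by
  induction n with
  | zero =>
    convert MeasurePreserving.id _
  | succ n ih =>
    have h1 := volume_preserving_piFinSuccAbove (fun _ : Fin (n + 1) => E) 0
    have h2 : MeasurePreserving (fun p : E × (Fin n → E) => (p.1, dif (fun i => p.2 i - p.1)))
        (volume.prod volume) (volume.prod volume) := by
      refine (MeasurePreserving.id (volume : Measure E)).skew_product
        (g := fun (a : E) (c : Fin n → E) => dif (fun i => c i - a)) ?_ ?_
      · apply measurable_dif.comp
        fun_prop
      · refine Eventually.of_forall fun a => ?_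
        exact (ih.comp (volume_preserving_pi (fun i => measurePreserving_sub_right volume a))).map_eq
    have h3 := h1.symm.comp (h2.comp h1)
    have key : (dif : (Fin (n + 1) → E) → Fin (n + 1) → E) =
      ((MeasurableEquiv.piFinSuccAbove (fun _ : Fin (n + 1) => E) 0).symm ∘
        (fun p : E × (Fin n → E) => (p.1, dif (fun i => p.2 i - p.1))) ∘
        (MeasurableEquiv.piFinSuccAbove (fun _ : Fin (n + 1) => E) 0)) := by
      funext z i
      refine Fin.cases ?_ (fun i => ?_) i
      · simp [dif]
      · simp only [dif, Function.comp, MeasurableEquiv.piFinSuccAbove_symm_apply,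
          MeasurableEquiv.piFinSuccAbove_apply, Fin.insertNthEquiv_zero, Fin.consEquiv_apply,
          Fin.cons_succ, Fin.consEquiv_symm_apply, Fin.tail]
        cases n with
        | zero => exact i.elim0
        | succ n =>
          refine Fin.cases ?_ (fun i => ?_) i
          · simp
          · simp only [← Fin.succ_castSucc, Fin.cons_succ]
            simp
    rw [key]
    exact h3


noncomputable def kk (x : ℝ) : ENNReal :=
  if 0 < x then ENNReal.ofReal (x ^ (-(1/2) : ℝ)) else ⊤

theorem kk_ne_zero (x : ℝ) : kk x ≠ 0 := by
  unfold kk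
  split_ifs with h
  · simp; positivity
  · simp

theorem measurable_kk : Measurable kk :=
  Measurable.ite measurableSet_Ioi (by fun_prop) measurable_const

noncomputable def GG {n : ℕ} (s : Fin n → ℝ) : ENNReal := ∏ i, kk (dif s i)

theorem measurable_GG {n : ℕ} : Measurable (GG : (Fin n → ℝ) → ENNReal) :=
  Finset.measurable_prod _ fun i _ => measurable_kk.comp ((measurable_pi_apply i).comp measurable_dif)

def Mon (n : ℕ) (T : ℝ) : Set (Fin n → ℝ) := {s | Monotone s ∧ ∀ i, s i ∈ Icc 0 T}

theorem measurableSet_Mon (n : ℕ) (T : ℝ) : MeasurableSet (Mon n T) := by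
  have h : Mon n T = (⋂ i : Fin n, ⋂ j : Fin n, ⋂ _ : i ≤ j, {s | s i ≤ s j}) ∩ ⋂ i : Fin n, {s | s i ∈ Icc 0 T} := by
    ext s; simp only [Mon, Monotone, mem_ofPred_eq, mem_inter_iff, mem_iInter]
  rw [h]
  refine MeasurableSet.inter ?_ ?_
  · refine MeasurableSet.iInter fun i => MeasurableSet.iInter fun j => MeasurableSet.iInter fun _ => ?_
    exact measurableSet_le (measurable_pi_apply i) (measurable_pi_apply j)
  · exact MeasurableSet.iInter fun i => measurableSet_Icc.preimage (measurable_pi_apply i)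

noncomputable def gg {n : ℕ} (T : ℝ) (s : Fin n → ℝ) : ENNReal :=
  ∑ σ : Equiv.Perm (Fin n), (Mon n T).indicator GG (s ∘ σ)

noncomputable def phi (a x : ℝ) : ENNReal := (Ici 0).indicator (fun x => ENNReal.ofReal (rexp (-a * x)) * kk x) x

theorem measurable_phi (a : ℝ) : Measurable (phi a) :=
  Measurable.indicator (by have := measurable_kk; fun_prop) measurableSet_Ici

theorem lint_phi (a : ℝ) (ha : 0 < a) : ∫⁻ x, phi a x = ENNReal.ofReal (√(π / a)) := by
  unfold phi
  rw [lintegral_indicator measurableSet_Ici, ← setLIntegral_congr (Ioi_ae_eq_Ici)]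
  have h := Real.integral_rpow_mul_exp_neg_mul_Ioi (a := 1/2) (r := a) (by norm_num) ha
  have e : ∫⁻ x in Ioi (0:ℝ), ENNReal.ofReal (rexp (-a * x)) * kk x =
      ∫⁻ x in Ioi (0:ℝ), ENNReal.ofReal (x ^ ((1/2:ℝ) - 1) * rexp (-(a * x))) := by
    refine setLIntegral_congr_fun measurableSet_Ioi fun x hx => ?_
    have hx' : 0 < x := hx
    simp only [kk, hx', if_true]
    rw [← ENNReal.ofReal_mul (by positivity), mul_comm]
    norm_num
  rw [e, ← ofReal_integral_eq_lintegral_ofReal, h]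
  · rw [Real.Gamma_one_half_eq, ← Real.sqrt_eq_rpow, ← Real.sqrt_mul (by positivity)]
    congr 2; field_simp
  · by_contra hn
    rw [integral_undef hn] at h
    have : 0 < (1 / a) ^ (1 / 2 : ℝ) * Real.Gamma (1/2) := by
      have := Real.Gamma_pos_of_pos (show (0:ℝ) < 1/2 by norm_num)
      positivity
    linarith
  · refine (ae_restrict_iff' measurableSet_Ioi).2 (Eventually.of_forall fun x hx => ?_)
    have hx' : 0 < x := hx
    positivity

theorem sum_dif_le {n : ℕ} {T : ℝ} (hT : 0 ≤ T) (s : Fin n → ℝ) (hs : s ∈ Mon n T) : ∑ i, dif s i ≤ T := by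
  have h : ∑ i, dif s i = Fin.partialSum (dif s) (Fin.last n) := by
    rw [Fin.partialSum, Fin.val_last, List.take_of_length_le (by simp), List.sum_ofFn]
  rw [h, partialSum_dif]
  generalize Fin.last n = j
  refine Fin.cases ?_ (fun i => ?_) j
  · simpa using hT
  · simpa using (hs.2 i).2

theorem dif_nonneg {n : ℕ} {T : ℝ} (s : Fin n → ℝ) (hs : s ∈ Mon n T) (i : Fin n) : 0 ≤ dif s i := by
  unfold dif
  cases n with
  | zero => exact i.elim0
  | succ n =>
    refine Fin.cases ?_ (fun i => ?_) i
    · simpa using (hs.2 0).1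
    · simp only [← Fin.succ_castSucc, Fin.cons_succ]
      linarith [hs.1 (Fin.castSucc_lt_succ (i := i)).le]

theorem GG_le {n : ℕ} {T a : ℝ} (hT : 0 ≤ T) (ha : 0 ≤ a) (s : Fin n → ℝ) (hs : s ∈ Mon n T) :
    GG s ≤ ENNReal.ofReal (rexp (a * T)) * ∏ i, phi a (dif s i) := by
  have h1 : ∀ i, phi a (dif s i) = ENNReal.ofReal (rexp (-a * dif s i)) * kk (dif s i) := by
    intro i
    rw [phi, indicator_of_mem (show dif s i ∈ Ici 0 from dif_nonneg s hs i)]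
  simp only [h1]
  rw [Finset.prod_mul_distrib, ← ENNReal.ofReal_prod_of_nonneg (fun i _ => (Real.exp_pos _).le),
    ← Real.exp_sum, ← mul_assoc, ← ENNReal.ofReal_mul (Real.exp_pos _).le, ← Real.exp_add,
    ← Finset.mul_sum]
  refine le_mul_of_one_le_left (by simp) ?_
  rw [ENNReal.one_le_ofReal, Real.one_le_exp_iff]
  nlinarith [sum_dif_le hT s hs]

theorem lint_Mon {n : ℕ} {T a : ℝ} (hT : 0 ≤ T) (ha : 0 < a) :
    ∫⁻ s, (Mon n T).indicator GG s ≤ ENNReal.ofReal (rexp (a * T)) * ENNReal.ofReal (√(π / a)) ^ n := by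
  have hm : Measurable fun x : Fin n → ℝ => ∏ i, phi a (x i) :=
    Finset.measurable_prod _ fun i _ => (measurable_phi a).comp (measurable_pi_apply i)
  calc ∫⁻ s, (Mon n T).indicator GG s
      ≤ ∫⁻ s, ENNReal.ofReal (rexp (a * T)) * ∏ i, phi a (dif s i) := by
        refine lintegral_mono fun s => ?_
        by_cases hs : s ∈ Mon n T
        · rw [indicator_of_mem hs]; exact GG_le hT ha.le s hs
        · rw [indicator_of_notMem hs]; exact zero_le
    _ = ENNReal.ofReal (rexp (a * T)) * ∫⁻ s : Fin n → ℝ, ∏ i, phi a (dif s i) :=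
        lintegral_const_mul _ (hm.comp measurable_dif)
    _ = ENNReal.ofReal (rexp (a * T)) * ∫⁻ s : Fin n → ℝ, ∏ i, phi a (s i) := by
        rw [(mp_dif n).lintegral_comp hm]
    _ = _ := by
        rw [volume_pi, lint_pi _ _ (fun _ => measurable_phi a)]
        simp [lint_phi a ha]

theorem lint_gg {n : ℕ} {T : ℝ} (hT : 0 < T) (hn : 0 < n) :
    ∫⁻ s : Fin n → ℝ, gg T s ≤ n.factorial * (ENNReal.ofReal (rexp n) * ENNReal.ofReal (√(π * T / n)) ^ n) := by
  have hm : Measurable ((Mon n T).indicator GG) := measurable_GG.indicator (measurableSet_Mon n T)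
  unfold gg
  rw [lintegral_finsetSum]
  · have : ∀ σ : Equiv.Perm (Fin n), ∫⁻ s : Fin n → ℝ, (Mon n T).indicator GG (s ∘ σ) = ∫⁻ s, (Mon n T).indicator GG s := by
      intro σ
      have := (volume_measurePreserving_piCongrLeft (fun _ : Fin n => ℝ) σ).symm
      rw [← this.lintegral_comp hm]
      rfl
    simp only [this]
    simp only [Finset.sum_const, Finset.card_univ, Fintype.card_perm, Fintype.card_fin, nsmul_eq_mul]
    gcongr
    have := lint_Mon (n := n) hT.le (show 0 < n / T by positivity)
    rwa [div_mul_cancel₀ _ hT.ne', div_div_eq_mul_div] at this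
  · intro σ _
    exact hm.comp (measurable_pi_lambda _ fun i => measurable_pi_apply _)

noncomputable def KK : ℝ := rexp 2 * π

theorem KK_pos : 0 < KK := by unfold KK; positivity

theorem lint_gg_sq {n : ℕ} {T : ℝ} (hT : 0 < T) (hn : 0 < n) :
    (∫⁻ s : Fin n → ℝ, gg T s) * (∫⁻ s : Fin n → ℝ, gg T s) ≤ ENNReal.ofReal (n.factorial * (KK * T) ^ n) := by
  refine (mul_le_mul' (lint_gg hT hn) (lint_gg hT hn)).trans ?_
  have e : (n.factorial : ENNReal) * (ENNReal.ofReal (rexp n) * ENNReal.ofReal (√(π * T / n)) ^ n)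
    = ENNReal.ofReal (n.factorial * (rexp n * √(π * T / n) ^ n)) := by
    rw [ENNReal.ofReal_mul (by positivity), ENNReal.ofReal_mul (by positivity), ENNReal.ofReal_pow (by positivity)]
    simp
  rw [e, ← ENNReal.ofReal_mul (by positivity)]
  apply ENNReal.ofReal_le_ofReal
  have h1 : (√(π * T / n) ^ n) * (√(π * T / n) ^ n) = (π * T) ^ n / n ^ n := by
    rw [← mul_pow, Real.mul_self_sqrt (by positivity), div_pow]
  have h2 : rexp n * rexp n = rexp 2 ^ n := by
    rw [← Real.exp_nat_mul, ← Real.exp_add]; ring_nf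
  have h3 : (n.factorial : ℝ) ≤ n ^ n := by exact_mod_cast Nat.factorial_le_pow n
  have h4 : (0:ℝ) < n ^ n := by positivity
  calc (n.factorial * (rexp n * √(π * T / n) ^ n)) * (n.factorial * (rexp n * √(π * T / n) ^ n))
      = n.factorial * n.factorial * (rexp n * rexp n) * ((√(π * T / n) ^ n) * (√(π * T / n) ^ n)) := by ring
    _ = n.factorial * (n.factorial / n ^ n) * (KK * T) ^ n := by
        rw [h1, h2, KK, mul_pow, mul_pow, mul_pow]; ring
    _ ≤ n.factorial * 1 * (KK * T) ^ n := by
        have := KK_pos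
        gcongr
        rw [div_le_one h4]; exact h3
    _ = _ := by ring


structure Incr {Ω : Type*} [MeasurableSpace Ω] (P : Measure Ω) (T : ℝ)
    (U : ℝ → Ω → Fin 2 → ℝ) : Prop where
  zero : ∀ ω, U 0 ω = 0
  meas : ∀ t, Measurable (U t)
  cont : ∀ ω, Continuous fun t => U t ω
  law : ∀ (n : ℕ) (t : Fin (n + 1) → ℝ), t 0 = 0 → Monotone t → (∀ i, t i ≤ T) →
    P.map (fun ω (k : Fin n) => U (t k.succ) ω - U (t k.castSucc) ω) =
      Measure.pi (fun k => gaussianPi (Fin 2) (t k.succ - t k.castSucc).toNNReal)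

instance (v : NNReal) : IsProbabilityMeasure (gaussianPi (Fin 2) v) := by
  unfold gaussianPi; infer_instance

theorem hasL2_path {Ω : Type*} [MeasurableSpace Ω] {P : Measure Ω} {T : ℝ} (hT : 0 ≤ T)
    {U : ℝ → Ω → Fin 2 → ℝ} (hU : Incr P T U) {n : ℕ} (s : Fin n → ℝ) (hs : s ∈ Mon n T)
    (hd : ∀ i, 0 < dif s i) :
    HasL2 (P.map (fun ω i => U (s i) ω)) (∏ i, ENNReal.ofReal (dif s i)⁻¹) := by
  have hlaw := hU.law n (Fin.cons 0 s) rfl ?_ ?_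
  · have e1 : (fun ω i => U (s i) ω) = (difEquiv (Fin 2 → ℝ) n).symm ∘
        (fun ω (k : Fin n) => U ((Fin.cons 0 s : Fin (n+1) → ℝ) k.succ) ω - U ((Fin.cons 0 s : Fin (n+1) → ℝ) k.castSucc) ω) := by
      funext ω
      rw [Function.comp, MeasurableEquiv.eq_symm_apply]
      change dif (E := Fin 2 → ℝ) (fun i => U (s i) ω) = _
      funext i
      simp only [dif, Fin.cons_succ]
      congr 1
      generalize i.castSucc = j
      refine Fin.cases ?_ (fun i => ?_) j
      · simp [hU.zero]
      · simp
    have hm : Measurable (fun ω (k : Fin n) => U ((Fin.cons 0 s : Fin (n+1) → ℝ) k.succ) ω - U ((Fin.cons 0 s : Fin (n+1) → ℝ) k.castSucc) ω) :=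
      measurable_pi_lambda _ fun k => (hU.meas _).sub (hU.meas _)
    rw [e1, ← Measure.map_map (MeasurableEquiv.measurable _) hm, hlaw]
    have hmp : MeasurePreserving (difEquiv (Fin 2 → ℝ) n) volume volume := mp_dif n
    refine HasL2.map ?_ (difEquiv (Fin 2 → ℝ) n).symm hmp.symm
    refine HasL2.pi _ _ fun i => ?_
    exact hasL2_gaussPi _ (hd i)
  · rw [Fin.monotone_iff_le_succ]
    intro i
    have := dif_nonneg s hs i
    simp only [dif] at this
    simp only [Fin.cons_succ]; linarith
  · intro i
    refine Fin.cases ?_ (fun i => ?_) i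
    · simpa using hT
    · simpa using (hs.2 i).2

def permEquiv (n : ℕ) (σ : Equiv.Perm (Fin n)) : (Fin n → Fin 2 → ℝ) ≃ᵐ (Fin n → Fin 2 → ℝ) :=
  MeasurableEquiv.piCongrLeft (fun _ : Fin n => Fin 2 → ℝ) σ

theorem hasL2_path_perm {Ω : Type*} [MeasurableSpace Ω] {P : Measure Ω} {T : ℝ} (hT : 0 ≤ T)
    {U : ℝ → Ω → Fin 2 → ℝ} (hU : Incr P T U) {n : ℕ} (s : Fin n → ℝ) (σ : Equiv.Perm (Fin n))
    (hs : s ∘ σ ∈ Mon n T)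
    (hd : ∀ i, 0 < dif (s ∘ σ) i) :
    HasL2 (P.map (fun ω i => U (s i) ω)) (∏ i, ENNReal.ofReal (dif (s ∘ σ) i)⁻¹) := by
  have h := hasL2_path hT hU (s ∘ σ) hs hd
  have h2 := h.map (MeasurableEquiv.piCongrLeft (fun _ : Fin n => Fin 2 → ℝ) σ)
    (volume_measurePreserving_piCongrLeft (fun _ : Fin n => Fin 2 → ℝ) σ)
  rw [Measure.map_map (MeasurableEquiv.measurable _) (measurable_pi_lambda _ fun i => hU.meas _)] at h2
  convert h2 using 2
  funext ω
  rw [Function.comp, ← MeasurableEquiv.symm_apply_eq]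
  rfl

theorem GG_sqrt {n : ℕ} (s : Fin n → ℝ) (hd : ∀ i, 0 < dif s i) :
    (∏ i, ENNReal.ofReal (dif s i)⁻¹) ^ (1/2 : ℝ) = GG s := by
  rw [← ENNReal.prod_rpow_of_nonneg (by norm_num)]
  refine Finset.prod_congr rfl fun i _ => ?_
  have := hd i
  rw [kk, if_pos (hd i), ENNReal.ofReal_rpow_of_nonneg (by positivity) (by norm_num),
    Real.inv_rpow (hd i).le, Real.rpow_neg (hd i).le]

theorem GG_ne_zero {n : ℕ} (s : Fin n → ℝ) : GG s ≠ 0 := by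
  rw [GG, Finset.prod_ne_zero_iff]
  exact fun i _ => kk_ne_zero _

theorem GG_top {n : ℕ} {s : Fin n → ℝ} (hd : ¬ ∀ i, 0 < dif s i) : GG s = ⊤ := by
  push Not at hd
  obtain ⟨i, hi⟩ := hd
  rw [GG, ← Finset.mul_prod_erase _ _ (Finset.mem_univ i), kk, if_neg (not_lt.2 hi), ENNReal.top_mul]
  rw [Finset.prod_ne_zero_iff]
  exact fun i _ => kk_ne_zero _

theorem joint_bound {Ω : Type*} [MeasurableSpace Ω] {P : Measure Ω} [IsProbabilityMeasure P]
    {T : ℝ} (hT : 0 ≤ T)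
    {U V : ℝ → Ω → Fin 2 → ℝ} (hU : Incr P T U) (hV : Incr P T V)
    (hI : IndepFun (fun ω (p : ℝ × Fin 2) => U p.1 ω p.2) (fun ω (p : ℝ × Fin 2) => V p.1 ω p.2) P)
    (r : (Fin 2 → ℝ) → ENNReal) (hr : Measurable r) (hr1 : ∫⁻ x, r x ≤ 1)
    {n : ℕ} (s u : Fin n → ℝ) (hs : ∀ i, s i ∈ Icc 0 T) (hu : ∀ i, u i ∈ Icc 0 T) :
    ∫⁻ ω, ∏ i, r (U (s i) ω + V (u i) ω) ∂P ≤ gg T s * gg T u := by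
  have hs' : s ∘ Tuple.sort s ∈ Mon n T := ⟨Tuple.monotone_sort s, fun i => hs _⟩
  have hu' : u ∘ Tuple.sort u ∈ Mon n T := ⟨Tuple.monotone_sort u, fun i => hu _⟩
  have h1 : ∀ w : Fin n → ℝ, w ∘ Tuple.sort w ∈ Mon n T → GG (w ∘ Tuple.sort w) ≤ gg T w := by
    intro w hw
    unfold gg
    refine le_trans (le_of_eq ?_) (Finset.single_le_sum (f := fun σ : Equiv.Perm (Fin n) => (Mon n T).indicator GG (w ∘ σ)) (fun _ _ => by simp) (Finset.mem_univ (Tuple.sort w)))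
    simp only [indicator_of_mem hw]
  refine le_trans ?_ (mul_le_mul' (h1 s hs') (h1 u hu'))
  by_cases hds : ∀ i, 0 < dif (s ∘ Tuple.sort s) i
  swap
  · rw [GG_top hds, ENNReal.top_mul (GG_ne_zero _)]; exact le_top
  by_cases hdu : ∀ i, 0 < dif (u ∘ Tuple.sort u) i
  swap
  · rw [GG_top hdu, ENNReal.mul_top (GG_ne_zero _)]; exact le_top
  have a1 := hasL2_path_perm hT hU s _ hs' hds
  have a2 := hasL2_path_perm hT hV u _ hu' hdu
  have hf : Measurable fun x : Fin n → Fin 2 → ℝ => ∏ i, r (x i) :=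
    Finset.measurable_prod _ fun i _ => hr.comp (measurable_pi_apply i)
  have key := HasL2.conv a1 a2 (fun x => ∏ i, r (x i)) hf
  have hone : ∫⁻ x : Fin n → Fin 2 → ℝ, ∏ i, r (x i) ≤ 1 := by
    rw [volume_pi, lint_pi _ _ (fun _ => hr)]
    exact Finset.prod_le_one' fun i _ => hr1
  rw [GG_sqrt _ hds, GG_sqrt _ hdu] at key
  have mU : Measurable fun ω i => U (s i) ω := measurable_pi_lambda _ fun i => hU.meas _
  have mV : Measurable fun ω i => V (u i) ω := measurable_pi_lambda _ fun i => hV.meas _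
  have ind : IndepFun (fun ω i => U (s i) ω) (fun ω i => V (u i) ω) P := by
    have := hI.comp (φ := fun (x : ℝ × Fin 2 → ℝ) (i : Fin n) (j : Fin 2) => x (s i, j))
      (ψ := fun (x : ℝ × Fin 2 → ℝ) (i : Fin n) (j : Fin 2) => x (u i, j)) (by fun_prop) (by fun_prop)
    exact this
  have h2 : ∫⁻ ω, ∏ i, r (U (s i) ω + V (u i) ω) ∂P =
      ∫⁻ z, ∫⁻ w, ∏ i, r ((z + w) i) ∂(P.map fun ω i => V (u i) ω) ∂(P.map fun ω i => U (s i) ω) := by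
    have hf2 : Measurable fun p : (Fin n → Fin 2 → ℝ) × (Fin n → Fin 2 → ℝ) => ∏ i, r ((p.1 + p.2) i) :=
      hf.comp (measurable_fst.add measurable_snd)
    have := (indepFun_iff_map_prod_eq_prod_map_map mU.aemeasurable mV.aemeasurable).1 ind
    rw [← lintegral_prod _ hf2.aemeasurable, ← this, lintegral_map hf2 (mU.prodMk mV)]
    rfl
  rw [h2]
  refine key.trans ?_
  calc _ ≤ GG (s ∘ Tuple.sort s) * GG (u ∘ Tuple.sort u) * 1 := by gcongr
    _ = _ := mul_one _

theorem measurable_gg {n : ℕ} (T : ℝ) : Measurable (gg T : (Fin n → ℝ) → ENNReal) := by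
  have hm : Measurable ((Mon n T).indicator GG) := measurable_GG.indicator (measurableSet_Mon n T)
  exact Finset.measurable_sum _ fun σ _ => hm.comp (measurable_pi_lambda _ fun i => measurable_pi_apply _)

theorem moment_bound {Ω : Type*} [MeasurableSpace Ω] {P : Measure Ω} [IsProbabilityMeasure P]
    {T : ℝ} (hT : 0 < T)
    {U V : ℝ → Ω → Fin 2 → ℝ} (hU : Incr P T U) (hV : Incr P T V)
    (hI : IndepFun (fun ω (p : ℝ × Fin 2) => U p.1 ω p.2) (fun ω (p : ℝ × Fin 2) => V p.1 ω p.2) P)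
    (r : (Fin 2 → ℝ) → ENNReal) (hr : Measurable r) (hr1 : ∫⁻ x, r x ≤ 1) (n : ℕ) :
    ∫⁻ ω, (∫⁻ p in Icc (0:ℝ) T ×ˢ Icc (0:ℝ) T, r (U p.2 ω + V p.1 ω)) ^ n ∂P ≤
      ENNReal.ofReal (n.factorial * (KK * T) ^ n) := by
  rcases Nat.eq_zero_or_pos n with rfl | hn
  · simp
  have mU : Measurable (Function.uncurry U) := measurable_uncurry_of_continuous_of_measurable hU.cont hU.meas
  have mV : Measurable (Function.uncurry V) := measurable_uncurry_of_continuous_of_measurable hV.cont hV.meas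
  have mr : Measurable fun q : Ω × (ℝ × ℝ) => r (U q.2.2 q.1 + V q.2.1 q.1) := by
    apply hr.comp
    exact (mU.comp (measurable_snd.snd.prodMk measurable_fst)).add
      (mV.comp (measurable_snd.fst.prodMk measurable_fst))
  have hS : MeasurableSet (Icc (0:ℝ) T ×ˢ Icc (0:ℝ) T) := measurableSet_Icc.prod measurableSet_Icc
  set μ : Measure (ℝ × ℝ) := volume.restrict (Icc (0:ℝ) T ×ˢ Icc (0:ℝ) T) with hμ
  set ν : Measure ℝ := volume.restrict (Icc (0:ℝ) T) with hν
  have hμν : μ = ν.prod ν := by rw [hμ, hν, Measure.prod_restrict]; rfl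
  have h1 : ∀ ω, (∫⁻ p, r (U p.2 ω + V p.1 ω) ∂μ) ^ n =
      ∫⁻ p : Fin n → ℝ × ℝ, ∏ i, r (U (p i).2 ω + V (p i).1 ω) ∂(Measure.pi fun _ => μ) := by
    intro ω
    rw [lint_pi (fun _ => μ) (fun _ (p : ℝ × ℝ) => r (U p.2 ω + V p.1 ω)) (fun _ => mr.comp measurable_prodMk_left)]
    simp
  simp only [h1]
  rw [lintegral_lintegral_swap]
  swap
  · apply Measurable.aemeasurable
    refine Finset.measurable_prod _ fun i _ => ?_
    exact mr.comp (measurable_fst.prodMk ((measurable_pi_apply i).comp measurable_snd))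
  have hmp := measurePreserving_arrowProdEquivProdArrow ℝ ℝ (Fin n) (fun _ => ν) (fun _ => ν)
  have hgm : Measurable fun q : (Fin n → ℝ) × (Fin n → ℝ) => gg T q.2 * gg T q.1 :=
    ((measurable_gg T).comp measurable_snd).mul ((measurable_gg T).comp measurable_fst)
  have hle : (Measure.pi fun _ : Fin n => ν) ≤ volume := by
    rw [hν, ← Measure.restrict_pi_pi, ← volume_pi]
    exact Measure.restrict_le_self
  calc ∫⁻ p : Fin n → ℝ × ℝ, ∫⁻ ω, ∏ i, r (U (p i).2 ω + V (p i).1 ω) ∂P ∂(Measure.pi fun _ => μ)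
      ≤ ∫⁻ p : Fin n → ℝ × ℝ, gg T (fun i => (p i).2) * gg T (fun i => (p i).1) ∂(Measure.pi fun _ => μ) := by
        apply lintegral_mono_ae
        have : (Measure.pi fun _ : Fin n => μ) = volume.restrict (Set.univ.pi fun _ => Icc (0:ℝ) T ×ˢ Icc (0:ℝ) T) := by
          rw [hμ, ← Measure.restrict_pi_pi, ← volume_pi]
        rw [this]
        refine (ae_restrict_iff' (MeasurableSet.univ_pi fun _ => hS)).2 (Eventually.of_forall fun p hp => ?_)
        exact joint_bound hT.le hU hV hI r hr hr1 _ _ (fun i => (hp i trivial).2) (fun i => (hp i trivial).1)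
    _ = ∫⁻ q : (Fin n → ℝ) × (Fin n → ℝ), gg T q.2 * gg T q.1
          ∂((Measure.pi fun _ => ν).prod (Measure.pi fun _ => ν)) := by
        rw [← hmp.lintegral_comp hgm, hμν]
        rfl
    _ = (∫⁻ s, gg T s ∂(Measure.pi fun _ : Fin n => ν)) * (∫⁻ s, gg T s ∂(Measure.pi fun _ : Fin n => ν)) := by
        simp only [mul_comm (gg T _) (gg T _)]
        exact lintegral_prod_mul (measurable_gg T).aemeasurable (measurable_gg T).aemeasurable
    _ ≤ (∫⁻ s : Fin n → ℝ, gg T s) * (∫⁻ s : Fin n → ℝ, gg T s) := by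
        gcongr
    _ ≤ _ := lint_gg_sq hT hn


section bm
variable {Ω : Type*} [MeasurableSpace Ω] {P : Measure Ω} {ι : Type*} [Fintype ι]

theorem bm_law {W : ℝ → Ω → ι → ℝ} (hW : IsStdBM P W) (t : ℝ) (ht : 0 ≤ t) :
    P.map (W t) = gaussianPi ι t.toNNReal := by
  have := hW.gauss_incr 0 t le_rfl ht
  simpa [hW.init] using this

theorem bm_coord {W : ℝ → Ω → ι → ℝ} (hW : IsStdBM P W) (t : ℝ) (ht : 0 ≤ t) (i : ι) :
    P.map (fun ω => W t ω i) = gaussianReal 0 t.toNNReal := by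
  have h := bm_law hW t ht
  have : (fun ω => W t ω i) = (fun x : ι → ℝ => x i) ∘ W t := rfl
  rw [this, ← Measure.map_map (measurable_pi_apply i) (hW.meas t), h, gaussianPi]
  exact (measurePreserving_eval (fun _ : ι => gaussianReal 0 t.toNNReal) i).map_eq

theorem bm_coord_gauss {W : ℝ → Ω → ι → ℝ} (hW : IsStdBM P W) (t : ℝ) (ht : 0 ≤ t) (i : ι) :
    HasGaussianLaw (fun ω => W t ω i) P := by
  refine ⟨?_⟩
  rw [bm_coord hW t ht]; infer_instance

theorem bm_coord_indep {W : ℝ → Ω → ι → ℝ} (hW : IsStdBM P W) (t : ℝ) (ht : 0 ≤ t) :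
    iIndepFun (fun i ω => W t ω i) P := by
  have := hW.isProb
  refine (iIndepFun_iff_map_fun_eq_pi_map (f := fun i ω => W t ω i) (fun i => ((measurable_pi_apply i).comp (hW.meas t)).aemeasurable)).2 ?_
  rw [show (fun ω i => W t ω i) = W t from rfl, bm_law hW t ht, gaussianPi]
  simp only [bm_coord hW t ht]

theorem bm_indepIncr {W : ℝ → Ω → ι → ℝ} (hW : IsStdBM P W) :
    HasIndepIncrements (fun t : NNReal => W t) P := by
  intro n t ht
  exact hW.indep_incr n (fun i => t i) (fun i => (t i).2) (fun i j h => by exact_mod_cast ht h)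

theorem bm_gauss {W : ℝ → Ω → ι → ℝ} (hW : IsStdBM P W) :
    IsGaussianProcess (fun t : NNReal => W t) P := by
  have := hW.isProb
  refine HasIndepIncrements.isGaussianProcess (fun t => ?_) (.of_forall fun ω => ?_) (bm_indepIncr hW)
  · exact iIndepFun.hasGaussianLaw (X := fun i ω => W t ω i) (fun i => bm_coord_gauss hW t t.2 i) (bm_coord_indep hW t t.2)
  · simpa using hW.init ω

open Classical in
noncomputable def CC (p q : NNReal × ι) : ℝ := if p.2 = q.2 then min p.1 q.1 else 0

theorem CC_comm (p q : NNReal × ι) : CC p q = CC q p := by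
  unfold CC
  by_cases h : p.2 = q.2
  · rw [if_pos h, if_pos h.symm, min_comm]
  · rw [if_neg h, if_neg (Ne.symm h)]

def GP (W : ℝ → Ω → ι → ℝ) (p : NNReal × ι) (ω : Ω) : ℝ := W p.1 ω p.2

theorem GP_gauss {W : ℝ → Ω → ι → ℝ} (hW : IsStdBM P W) :
    IsGaussianProcess (GP W) P := by
  refine IsGaussianProcess.of_isGaussianProcess (bm_gauss hW) fun p => ⟨{p.1},
    (ContinuousLinearMap.proj (R := ℝ) (φ := fun _ : ι => ℝ) p.2).comp
      (ContinuousLinearMap.proj (R := ℝ) (φ := fun _ : ({p.1} : Finset NNReal) => ι → ℝ) ⟨p.1, by simp⟩), fun ω => ?_⟩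
  rfl

theorem GP_mem {W : ℝ → Ω → ι → ℝ} (hW : IsStdBM P W) (p) : MemLp (GP W p) 2 P :=
  ((GP_gauss hW).hasGaussianLaw_eval p).memLp_two

theorem GP_meas {W : ℝ → Ω → ι → ℝ} (hW : IsStdBM P W) (p) : Measurable (GP W p) :=
  (measurable_pi_apply _).comp (hW.meas _)

theorem GP_cov {W : ℝ → Ω → ι → ℝ} (hW : IsStdBM P W) (p q) : cov[GP W p, GP W q; P] = CC p q := by
  have := hW.isProb
  wlog h : p.1 ≤ q.1 generalizing p q
  · rw [covariance_comm, CC_comm]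
    exact this q p (le_of_not_ge h)
  obtain ⟨s, i⟩ := p
  obtain ⟨t, j⟩ := q
  simp only at h
  have e : GP W (t, j) = GP W (s, j) + (fun ω => W t ω j - W s ω j) := by
    funext ω; simp [GP]
  have e0 : cov[GP W (s, i), (fun ω => W t ω j - W s ω j); P] = 0 := by
    apply IndepFun.covariance_eq_zero
    · have := (bm_indepIncr hW).indepFun_eval_sub (r := 0) (s := s) (t := t) (zero_le) h
        (.of_forall fun ω => by simpa using hW.init ω)
      exact this.comp (φ := fun x : ι → ℝ => x i) (ψ := fun x : ι → ℝ => x j) (by fun_prop) (by fun_prop)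
    · exact GP_mem hW _
    · exact (GP_mem hW (t, j)).sub (GP_mem hW (s, j))
  have m2 : MemLp (fun ω => W t ω j - W s ω j) 2 P := (GP_mem hW (t, j)).sub (GP_mem hW (s, j))
  rw [e, covariance_add_right (GP_mem hW _) (GP_mem hW _) m2, e0, add_zero]
  unfold CC
  simp only
  have hmin : min (s:ℝ) t = s := min_eq_left h
  split_ifs with hij
  · subst hij
    rw [covariance_self (GP_meas hW _).aemeasurable, hmin, ← variance_id_map (GP_meas hW _).aemeasurable]
    have := bm_coord hW s s.2 i
    rw [show GP W (s, i) = fun ω => W s ω i from rfl, this]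
    simp
  · exact ((bm_coord_indep hW s s.2).indepFun hij).covariance_eq_zero (GP_mem hW (s,i)) (GP_mem hW (s,j))

theorem GP_indep {W : ℝ → Ω → ι → ℝ} (hW : IsStdBM P W) {S T : Type*} (a b : S → NNReal × ι) (c d : T → NNReal × ι)
    (h : ∀ s t, CC (a s) (c t) - CC (a s) (d t) - (CC (b s) (c t) - CC (b s) (d t)) = 0) :
    IndepFun (fun ω s => GP W (a s) ω - GP W (b s) ω) (fun ω t => GP W (c t) ω - GP W (d t) ω) P := by
  have := hW.isProb
  refine IsGaussianProcess.indepFun_of_covariance_eq_zero (X := fun s ω => GP W (a s) ω - GP W (b s) ω)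
    (Y := fun t ω => GP W (c t) ω - GP W (d t) ω) ?_ ?_ ?_ ?_
  · classical
    refine IsGaussianProcess.of_isGaussianProcess (GP_gauss hW) ?_
    rintro (s | s)
    · refine ⟨{a s, b s}, (ContinuousLinearMap.proj (R := ℝ) (φ := fun _ : ({a s, b s} : Finset (NNReal × ι)) => ℝ) ⟨a s, by simp⟩) -
        (ContinuousLinearMap.proj (R := ℝ) (φ := fun _ : ({a s, b s} : Finset (NNReal × ι)) => ℝ) ⟨b s, by simp⟩), fun ω => ?_⟩
      simp
    · refine ⟨{c s, d s}, (ContinuousLinearMap.proj (R := ℝ) (φ := fun _ : ({c s, d s} : Finset (NNReal × ι)) => ℝ) ⟨c s, by simp⟩) -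
        (ContinuousLinearMap.proj (R := ℝ) (φ := fun _ : ({c s, d s} : Finset (NNReal × ι)) => ℝ) ⟨d s, by simp⟩), fun ω => ?_⟩
      simp
  · exact fun s => ((GP_meas hW _).sub (GP_meas hW _)).aemeasurable
  · exact fun s => ((GP_meas hW _).sub (GP_meas hW _)).aemeasurable
  · intro s t
    have e : ∀ p q, (fun ω => GP W p ω - GP W q ω) = GP W p - GP W q := fun _ _ => rfl
    rw [e, e, covariance_sub_left (GP_mem hW _) (GP_mem hW _) ((GP_mem hW _).sub (GP_mem hW _)),
      covariance_sub_right (GP_mem hW _) (GP_mem hW _) (GP_mem hW _),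
      covariance_sub_right (GP_mem hW _) (GP_mem hW _) (GP_mem hW _)]
    simp only [GP_cov hW]
    exact h s t

end bm


section bm2
variable {Ω : Type*} [MeasurableSpace Ω] {P : Measure Ω}

theorem bm_planar {κ : Type*} [Fintype κ] {W : ℝ → Ω → κ × Fin 2 → ℝ} (hW : IsStdBM P W) (k : κ) :
    IsStdBM P (planarComp W k) where
  isProb := hW.isProb
  init ω := by funext i; simp [planarComp, hW.init]
  cont ω i := hW.cont ω (k, i)
  meas t := measurable_pi_lambda _ fun i => (measurable_pi_apply _).comp (hW.meas t)
  indep_incr n t h0 hm := by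
    have := (hW.indep_incr n t h0 hm).comp (fun _ (x : κ × Fin 2 → ℝ) (i : Fin 2) => x (k, i)) (fun _ => by fun_prop)
    exact this
  gauss_incr s t hs hst := by
    have h := hW.gauss_incr s t hs hst
    have e : (fun ω => planarComp W k t ω - planarComp W k s ω) =
      (fun (x : κ × Fin 2 → ℝ) (i : Fin 2) => x (k, i)) ∘ (fun ω => W t ω - W s ω) := rfl
    have := hW.isProb
    have hms : Measurable (fun ω => W t ω - W s ω) := (hW.meas t).sub (hW.meas s)
    rw [e, ← Measure.map_map (by fun_prop) hms, h]
    set v := (t - s).toNNReal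
    have hi : iIndepFun (fun (p : κ × Fin 2) (x : κ × Fin 2 → ℝ) => x p) (gaussianPi (κ × Fin 2) v) :=
      iIndepFun_pi (μ := fun _ : κ × Fin 2 => gaussianReal 0 v) (X := fun _ x => x) (fun _ => aemeasurable_id)
    have hi2 := hi.precomp (g := fun i : Fin 2 => (k, i)) (fun i j h => by simpa using h)
    have hp : IsProbabilityMeasure (gaussianPi (κ × Fin 2) v) := by unfold gaussianPi; infer_instance
    have := (iIndepFun_iff_map_fun_eq_pi_map (f := fun (i : Fin 2) (x : κ × Fin 2 → ℝ) => x (k, i)) (fun i => (measurable_pi_apply _).aemeasurable)).1 hi2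
    rw [this]
    unfold gaussianPi
    congr 1
    funext i
    exact (measurePreserving_eval (fun _ : κ × Fin 2 => gaussianReal 0 v) (k, i)).map_eq

theorem incr_aux [IsProbabilityMeasure P] {n : ℕ} {X : Fin n → Ω → Fin 2 → ℝ} (hX : ∀ k, Measurable (X k)) (hi : iIndepFun X P)
    (v : Fin n → NNReal) (hv : ∀ k, P.map (X k) = gaussianPi (Fin 2) (v k)) :
    P.map (fun ω k => X k ω) = Measure.pi fun k => gaussianPi (Fin 2) (v k) := by
  rw [(iIndepFun_iff_map_fun_eq_pi_map (fun i => (hX i).aemeasurable)).1 hi]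
  simp only [hv]

theorem gaussianPi_neg (v : NNReal) : (gaussianPi (Fin 2) v).map (fun x => - x) = gaussianPi (Fin 2) v := by
  unfold gaussianPi
  have := Measure.pi_map_pi (μ := fun _ : Fin 2 => gaussianReal 0 v) (f := fun _ x => -x) (fun i => by fun_prop)
  simp only [gaussianReal_map_neg, neg_zero] at this
  exact this

variable {B : ℝ → Ω → Fin 2 → ℝ}

def fw (B : ℝ → Ω → Fin 2 → ℝ) (m : ℝ) (s : ℝ) (ω : Ω) : Fin 2 → ℝ := B (m + max s 0) ω - B m ω
def bw (B : ℝ → Ω → Fin 2 → ℝ) (m : ℝ) (s : ℝ) (ω : Ω) : Fin 2 → ℝ := B m ω - B (m - max 0 (min s m)) ω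
def ng (B : ℝ → Ω → Fin 2 → ℝ) (s : ℝ) (ω : Ω) : Fin 2 → ℝ := B 0 ω - B (max s 0) ω

theorem bm_cont (hB : IsStdBM P B) (ω : Ω) : Continuous fun t => B t ω :=
  continuous_pi fun i => hB.cont ω i

theorem fw_incr (hB : IsStdBM P B) {m : ℝ} (hm : 0 ≤ m) (T : ℝ) : Incr P T (fw B m) where
  zero ω := by simp [fw]
  meas t := (hB.meas _).sub (hB.meas _)
  cont ω := ((bm_cont hB ω).comp (by fun_prop)).sub continuous_const
  law n t t0 tm tT := by
    have := hB.isProb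
    have tp : ∀ i, 0 ≤ t i := fun i => t0 ▸ tm (Fin.zero_le i)
    have e : ∀ (k : Fin n) ω, fw B m (t k.succ) ω - fw B m (t k.castSucc) ω =
        B (m + t k.succ) ω - B (m + t k.castSucc) ω := by
      intro k ω; simp [fw, max_eq_left (tp _)]
    simp only [e]
    refine incr_aux (X := fun k ω => B (m + t k.succ) ω - B (m + t k.castSucc) ω)
      (fun k => (hB.meas _).sub (hB.meas _)) ?_ _ fun k => ?_
    · exact hB.indep_incr n (fun i => m + t i) (fun i => add_nonneg hm (tp i)) (fun i j h => by simpa using tm h)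
    · rw [hB.gauss_incr _ _ (add_nonneg hm (tp _)) (by simpa using tm (Fin.castSucc_le_succ k))]
      congr 2; ring

theorem bw_incr (hB : IsStdBM P B) {m : ℝ} (hm : 0 ≤ m) {T : ℝ} (hT : T ≤ m) : Incr P T (bw B m) where
  zero ω := by simp [bw, hm]
  meas t := (hB.meas _).sub (hB.meas _)
  cont ω := continuous_const.sub ((bm_cont hB ω).comp (by fun_prop))
  law n t t0 tm tT := by
    have := hB.isProb
    have tp : ∀ i, 0 ≤ t i := fun i => t0 ▸ tm (Fin.zero_le i)
    have tq : ∀ i, t i ≤ m := fun i => (tT i).trans hT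
    have e : ∀ (k : Fin n) ω, bw B m (t k.succ) ω - bw B m (t k.castSucc) ω =
        B (m - t k.castSucc) ω - B (m - t k.succ) ω := by
      intro k ω; simp [bw, max_eq_right (tp _), min_eq_left (tq _)]
    simp only [e]
    refine incr_aux (X := fun k ω => B (m - t k.castSucc) ω - B (m - t k.succ) ω)
      (fun k => (hB.meas _).sub (hB.meas _)) ?_ _ fun k => ?_
    · have := hB.indep_incr n (fun i => m - t (Fin.rev i)) (fun i => by simpa using tq _) 
        (fun i j h => sub_le_sub_left (tm (Fin.rev_le_rev.2 h)) m)
      have := this.precomp (g := Fin.rev) Fin.rev_injective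
      simpa only [Fin.rev_succ, Fin.rev_castSucc, Fin.rev_rev, Function.comp_def] using this
    · rw [hB.gauss_incr _ _ (by simpa using tq _) (sub_le_sub_left (tm (Fin.castSucc_le_succ k)) m)]
      congr 2; ring

theorem ng_incr (hB : IsStdBM P B) (T : ℝ) : Incr P T (ng B) where
  zero ω := by simp [ng]
  meas t := (hB.meas _).sub (hB.meas _)
  cont ω := continuous_const.sub ((bm_cont hB ω).comp (by fun_prop))
  law n t t0 tm tT := by
    have := hB.isProb
    have tp : ∀ i, 0 ≤ t i := fun i => t0 ▸ tm (Fin.zero_le i)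
    have e : ∀ (k : Fin n) ω, ng B (t k.succ) ω - ng B (t k.castSucc) ω =
        - (B (t k.succ) ω - B (t k.castSucc) ω) := by
      intro k ω; simp [ng, max_eq_left (tp _)]
    simp only [e]
    refine incr_aux (X := fun k ω => -(B (t k.succ) ω - B (t k.castSucc) ω))
      (fun k => ((hB.meas _).sub (hB.meas _)).neg) ?_ _ fun k => ?_
    · exact (hB.indep_incr n t tp tm).comp (fun _ x => - x) (fun _ => measurable_neg)
    · have h := hB.gauss_incr _ _ (tp _) (tm (Fin.castSucc_le_succ k))
      have h2 := Measure.map_map (μ := P) measurable_neg ((hB.meas (t k.succ)).sub (hB.meas (t k.castSucc)))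
      change (P.map fun ω => B (t k.succ) ω - B (t k.castSucc) ω).map _ = _ at h2
      rw [h, gaussianPi_neg] at h2
      exact h2.symm

theorem fwbw_indep (hB : IsStdBM P B) {m : ℝ} (hm : 0 ≤ m) :
    IndepFun (fun ω (p : ℝ × Fin 2) => fw B m p.1 ω p.2) (fun ω (p : ℝ × Fin 2) => bw B m p.1 ω p.2) P := by
  have h := GP_indep hB (S := ℝ × Fin 2) (T := ℝ × Fin 2)
    (fun p => (⟨m + max p.1 0, by positivity⟩, p.2)) (fun p => (⟨m, hm⟩, p.2))
    (fun p => (⟨m, hm⟩, p.2)) (fun p => (⟨m - max 0 (min p.1 m), by simp [hm]⟩, p.2)) ?_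
  · exact h
  · intro s t
    by_cases hst : s.2 = t.2
    · simp only [CC, if_pos hst]
      change min (m + max s.1 0) m - min (m + max s.1 0) (m - max 0 (min t.1 m)) - (min m m - min m (m - max 0 (min t.1 m))) = 0
      have h1 : (0:ℝ) ≤ max s.1 0 := le_max_right _ _
      have h2 : (0:ℝ) ≤ max 0 (min t.1 m) := le_max_left _ _
      generalize max s.1 0 = x at *
      generalize max 0 (min t.1 m) = y at *
      rw [min_eq_right (by linarith), min_eq_right (by linarith), min_eq_right (by linarith), min_eq_right (by linarith)]
      ring
    · simp [CC, hst]

theorem alpha_indep {κ : Type*} [Fintype κ] {W : ℝ → Ω → κ × Fin 2 → ℝ} (hW : IsStdBM P W) {k l : κ} (hkl : k ≠ l) :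
    IndepFun (fun ω (p : ℝ × Fin 2) => fw (planarComp W k) 0 p.1 ω p.2) (fun ω (p : ℝ × Fin 2) => ng (planarComp W l) p.1 ω p.2) P := by
  have h := GP_indep hW (S := ℝ × Fin 2) (T := ℝ × Fin 2)
    (fun p => (⟨0 + max p.1 0, by positivity⟩, (k, p.2))) (fun p => (⟨0, le_rfl⟩, (k, p.2)))
    (fun p => (⟨0, le_rfl⟩, (l, p.2))) (fun p => (⟨max p.1 0, by simp⟩, (l, p.2))) ?_
  · exact h
  · intro s t
    simp [CC, hkl]

end bm2


section ex
variable {Ω : Type*} [MeasurableSpace Ω] {P : Measure Ω} [IsProbabilityMeasure P]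

theorem bdd_int {f : Ω → ℝ} (hf : Measurable f) {C : ℝ} (h : ∀ ω, |f ω| ≤ C) : Integrable f P :=
  Integrable.of_bound hf.aestronglyMeasurable C (.of_forall h)

theorem exp_sum {A : Ω → ℝ} (hA : Measurable A) (h0 : ∀ ω, 0 ≤ A ω) {D : ℝ} (hD : ∀ ω, A ω ≤ D) {K : ℝ} (hK : 0 ≤ K)
    (hm : ∀ n : ℕ, ∫ ω, A ω ^ n ∂P ≤ n.factorial * K ^ n) {l : ℝ} (hl : 0 ≤ l) (hlK : l * K ≤ 1/2) :
    HasSum (fun n : ℕ => l ^ n / n.factorial * ∫ ω, A ω ^ n ∂P) (∫ ω, exp (l * A ω) ∂P) ∧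
     ∀ n : ℕ, l ^ n / n.factorial * ∫ ω, A ω ^ n ∂P ≤ (l * K) ^ n := by
  have hb : ∀ n : ℕ, l ^ n / n.factorial * ∫ ω, A ω ^ n ∂P ≤ (l * K) ^ n := by
    intro n
    calc l ^ n / n.factorial * ∫ ω, A ω ^ n ∂P ≤ l ^ n / n.factorial * (n.factorial * K ^ n) := by
          gcongr; exact hm n
      _ = (l * K) ^ n := by
          have : (n.factorial : ℝ) ≠ 0 := by positivity
          rw [mul_pow]; field_simp
  refine ⟨?_, hb⟩
  have hi : ∀ n : ℕ, Integrable (fun ω => A ω ^ n) P := fun n =>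
    bdd_int (hA.pow_const n) (C := D ^ n) fun ω => by
      rw [abs_of_nonneg (pow_nonneg (h0 ω) n)]; exact pow_le_pow_left₀ (h0 ω) (hD ω) n
  have key := hasSum_integral_of_summable_integral_norm (μ := P) (F := fun (n : ℕ) ω => l ^ n / n.factorial * A ω ^ n)
    (fun n => (hi n).const_mul _) ?_
  · simp only [integral_const_mul] at key
    have e : (fun ω => exp (l * A ω)) = fun ω => ∑' n : ℕ, l ^ n / n.factorial * A ω ^ n := by
      funext ω
      rw [Real.exp_eq_exp_ℝ, NormedSpace.exp_eq_tsum_div]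
      refine tsum_congr fun n => ?_
      rw [mul_pow]; ring
    rw [e]
    exact key
  · have : ∀ n : ℕ, ∫ ω, ‖l ^ n / n.factorial * A ω ^ n‖ ∂P = l ^ n / n.factorial * ∫ ω, A ω ^ n ∂P := by
      intro n
      rw [← integral_const_mul]
      congr 1
      funext ω
      rw [Real.norm_of_nonneg]
      have := h0 ω
      positivity
    simp only [this]
    refine Summable.of_nonneg_of_le (fun n => ?_) hb (summable_geometric_of_lt_one (by positivity) (by linarith))
    have : 0 ≤ ∫ ω, A ω ^ n ∂P := integral_nonneg fun ω => pow_nonneg (h0 ω) n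
    positivity

theorem exp_one {A : Ω → ℝ} (hA : Measurable A) (h0 : ∀ ω, 0 ≤ A ω) {D : ℝ} (hD : ∀ ω, A ω ≤ D) {K : ℝ} (hK : 0 ≤ K)
    (hm : ∀ n : ℕ, ∫ ω, A ω ^ n ∂P ≤ n.factorial * K ^ n) {l : ℝ} (hl : 0 ≤ l) (hlK : l * K ≤ 1/2) :
    ∫ ω, exp (l * A ω) ∂P ≤ 2 := by
  obtain ⟨h1, h2⟩ := exp_sum hA h0 hD hK hm hl hlK
  have h3 := hasSum_geometric_of_lt_one (r := l * K) (by positivity) (by linarith)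
  have := hasSum_le h2 h1 h3
  refine this.trans ?_
  rw [inv_le_comm₀ (by linarith) (by norm_num)]; linarith

theorem exp_two {A : Ω → ℝ} (hA : Measurable A) (h0 : ∀ ω, 0 ≤ A ω) {D : ℝ} (hD : ∀ ω, A ω ≤ D) {K : ℝ} (hK : 0 ≤ K)
    (hm : ∀ n : ℕ, ∫ ω, A ω ^ n ∂P ≤ n.factorial * K ^ n) {l : ℝ} (hl : 0 ≤ l) (hlK : l * K ≤ 1/2) :
    ∫ ω, exp (l * (A ω - ∫ ω', A ω' ∂P)) ∂P ≤ exp (2 * K ^ 2 * l ^ 2) := by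
  obtain ⟨h1, h2⟩ := exp_sum hA h0 hD hK hm hl hlK
  have h3 := hasSum_geometric_of_lt_one (r := l * K) (by positivity) (by linarith)
  have h1' := (hasSum_nat_add_iff' 2).2 h1
  have h3' := (hasSum_nat_add_iff' 2).2 h3
  have h4 := hasSum_le (fun n => h2 (n + 2)) h1' h3'
  simp only [Finset.sum_range_succ, Finset.sum_range_zero, Nat.factorial, pow_zero, pow_one, integral_const,
    probReal_univ] at h4
  norm_num at h4
  have h5 : (1 - l * K)⁻¹ ≤ 1 + l * K + 2 * K ^ 2 * l ^ 2 := by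
    rw [inv_le_iff_one_le_mul₀ (by linarith)]
    have : 0 ≤ l * K := by positivity
    nlinarith [mul_nonneg (mul_nonneg this this) (by linarith : 0 ≤ 1/2 - l * K)]
  have h6 : ∫ ω, exp (l * A ω) ∂P ≤ exp (l * ∫ ω, A ω ∂P + 2 * K ^ 2 * l ^ 2) := by
    have := Real.add_one_le_exp (l * ∫ ω, A ω ∂P + 2 * K ^ 2 * l ^ 2)
    linarith
  calc ∫ ω, exp (l * (A ω - ∫ ω', A ω' ∂P)) ∂P = exp (- (l * ∫ ω, A ω ∂P)) * ∫ ω, exp (l * A ω) ∂P := by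
        rw [← integral_const_mul]
        congr 1
        funext ω
        rw [← Real.exp_add]; congr 1; ring
    _ ≤ exp (- (l * ∫ ω, A ω ∂P)) * exp (l * ∫ ω, A ω ∂P + 2 * K ^ 2 * l ^ 2) := by gcongr
    _ = _ := by rw [← Real.exp_add]; congr 1; ring
end ex


structure Good (r : (Fin 2 → ℝ) → ℝ) (M : ℝ) : Prop where
  cont : Continuous r
  nonneg : ∀ x, 0 ≤ r x
  le : ∀ x, r x ≤ M
  int : ∫⁻ x, ENNReal.ofReal (r x) ≤ 1

theorem pint_meas {Ω : Type*} {mΩ : MeasurableSpace Ω} {r : (Fin 2 → ℝ) → ℝ} {M : ℝ} (hr : Good r M) (S : Set (ℝ × ℝ))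
    (Z : ℝ × ℝ → Ω → Fin 2 → ℝ) (hZ : ∀ p, Measurable (Z p)) (hc : ∀ ω, Continuous fun p => Z p ω) :
    Measurable fun ω => ∫ p in S, r (Z p ω) := by
  have mZ : Measurable (Function.uncurry Z) := measurable_uncurry_of_continuous_of_measurable hc hZ
  have : StronglyMeasurable fun q : Ω × (ℝ × ℝ) => r (Z q.2 q.1) :=
    (hr.cont.measurable.comp (mZ.comp measurable_swap)).stronglyMeasurable
  exact (this.integral_prod_right (ν := volume.restrict S)).measurable

section
variable {r : (Fin 2 → ℝ) → ℝ} {M : ℝ}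

theorem Good.M_nonneg (hr : Good r M) : 0 ≤ M := (hr.nonneg 0).trans (hr.le 0)

theorem pint_int (hr : Good r M) {S : Set (ℝ × ℝ)} (hS : volume S ≠ ⊤)
    (z : ℝ × ℝ → Fin 2 → ℝ) (hc : Continuous z) :
    IntegrableOn (fun p => r (z p)) S := by
  refine Measure.integrableOn_of_bounded hS (hr.cont.comp hc).aestronglyMeasurable (M := M) (.of_forall fun p => ?_)
  rw [Real.norm_of_nonneg (hr.nonneg _)]; exact hr.le _

theorem pint_nonneg (hr : Good r M) (S : Set (ℝ × ℝ)) (z : ℝ × ℝ → Fin 2 → ℝ) :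
    0 ≤ ∫ p in S, r (z p) := integral_nonneg fun p => hr.nonneg _

theorem pint_le (hr : Good r M) {S : Set (ℝ × ℝ)} (hS : volume S ≠ ⊤)
    (z : ℝ × ℝ → Fin 2 → ℝ) : ∫ p in S, r (z p) ≤ M * volume.real S := by
  have := norm_setIntegral_le_of_norm_le_const (μ := volume) (s := S) (f := fun p => r (z p)) (C := M) (lt_top_iff_ne_top.2 hS)
    (fun p _ => by rw [Real.norm_of_nonneg (hr.nonneg _)]; exact hr.le _)
  exact (le_abs_self _).trans this

theorem sq_moment {Ω : Type*} [MeasurableSpace Ω] {P : Measure Ω} [IsProbabilityMeasure P]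
    (hr : Good r M) {T : ℝ} (hT : 0 < T)
    {U V : ℝ → Ω → Fin 2 → ℝ} (hU : Incr P T U) (hV : Incr P T V)
    (hI : IndepFun (fun ω (p : ℝ × Fin 2) => U p.1 ω p.2) (fun ω (p : ℝ × Fin 2) => V p.1 ω p.2) P) (n : ℕ) :
    ∫ ω, (∫ p in Icc (0:ℝ) T ×ˢ Icc (0:ℝ) T, r (U p.2 ω + V p.1 ω)) ^ n ∂P ≤ n.factorial * (KK * T) ^ n := by
  have h := moment_bound hT hU hV hI (fun x => ENNReal.ofReal (r x)) (hr.cont.measurable.ennreal_ofReal) hr.int n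
  have hvol : volume (Icc (0:ℝ) T ×ˢ Icc (0:ℝ) T) ≠ ⊤ :=
    (isCompact_Icc.prod isCompact_Icc).measure_lt_top.ne
  have hc : ∀ ω, Continuous fun p : ℝ × ℝ => U p.2 ω + V p.1 ω := fun ω =>
    ((hU.cont ω).comp continuous_snd).add ((hV.cont ω).comp continuous_fst)
  have hm := pint_meas hr (Icc (0:ℝ) T ×ˢ Icc (0:ℝ) T) (fun p ω => U p.2 ω + V p.1 ω) (fun p => (hU.meas _).add (hV.meas _)) hc
  have e : ∀ ω, (∫⁻ p in Icc (0:ℝ) T ×ˢ Icc (0:ℝ) T, ENNReal.ofReal (r (U p.2 ω + V p.1 ω))) ^ n =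
      ENNReal.ofReal ((∫ p in Icc (0:ℝ) T ×ˢ Icc (0:ℝ) T, r (U p.2 ω + V p.1 ω)) ^ n) := by
    intro ω
    rw [← ofReal_integral_eq_lintegral_ofReal (pint_int hr hvol _ (hc ω)) (.of_forall fun p => hr.nonneg _),
      ENNReal.ofReal_pow (pint_nonneg hr _ _)]
  simp only [e] at h
  have hK : 0 ≤ KK * T := mul_nonneg KK_pos.le hT.le
  rw [integral_eq_lintegral_of_nonneg_ae (.of_forall fun ω => pow_nonneg (pint_nonneg hr _ _) n) (hm.pow_const n).aestronglyMeasurable]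
  refine ENNReal.toReal_le_of_le_ofReal (by positivity) h

def tri (a b : ℝ) : Set (ℝ × ℝ) := {p : ℝ × ℝ | a ≤ p.1 ∧ p.1 < p.2 ∧ p.2 ≤ b}

theorem meas_tri (a b : ℝ) : MeasurableSet (tri a b) := by
  apply MeasurableSet.inter (measurableSet_le measurable_const measurable_fst)
  exact MeasurableSet.inter (measurableSet_lt measurable_fst measurable_snd) (measurableSet_le measurable_snd measurable_const)

theorem tri_sub (a b : ℝ) : tri a b ⊆ Icc a b ×ˢ Icc a b := by
  rintro ⟨x, y⟩ ⟨h1, h2, h3⟩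
  simp only at h1 h2 h3
  exact ⟨⟨h1, by simp only; linarith⟩, ⟨by simp only; linarith, h3⟩⟩

theorem vol_sq (a b : ℝ) (h : a ≤ b) : volume.real (Icc a b ×ˢ Icc a b) = (b - a) * (b - a) := by
  rw [Measure.volume_eq_prod, measureReal_prod_prod, Real.volume_real_Icc_of_le h]

theorem vol_sq_top (a b c d : ℝ) : volume (Icc a b ×ˢ Icc c d) ≠ ⊤ := 
  (isCompact_Icc.prod isCompact_Icc).measure_lt_top.ne

theorem vol_tri_top (a b : ℝ) : volume (tri a b) ≠ ⊤ := 
  measure_ne_top_of_subset (tri_sub a b) (vol_sq_top a b a b)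

theorem vol_tri (a b : ℝ) (h : a ≤ b) : volume.real (tri a b) ≤ (b - a) * (b - a) := by
  rw [← vol_sq a b h]
  exact measureReal_mono (tri_sub a b) (vol_sq_top a b a b)

variable {Ω : Type*} [mΩ : MeasurableSpace Ω] {P : Measure Ω} {B : ℝ → Ω → Fin 2 → ℝ}

noncomputable def bt (r : (Fin 2 → ℝ) → ℝ) (B : ℝ → Ω → Fin 2 → ℝ) (a b : ℝ) (ω : Ω) : ℝ :=
  ∫ p in tri a b, r (B p.2 ω - B p.1 ω)

noncomputable def sqf (r : (Fin 2 → ℝ) → ℝ) (U V : ℝ → Ω → Fin 2 → ℝ) (T : ℝ) (ω : Ω) : ℝ :=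
  ∫ p in Icc (0:ℝ) T ×ˢ Icc (0:ℝ) T, r (U p.2 ω + V p.1 ω)

theorem cont_diff (hB : IsStdBM P B) (ω : Ω) : Continuous fun p : ℝ × ℝ => B p.2 ω - B p.1 ω :=
  ((bm_cont hB ω).comp continuous_snd).sub ((bm_cont hB ω).comp continuous_fst)

theorem bt_meas (hr : Good r M) (hB : IsStdBM P B) (a b : ℝ) : Measurable (bt r B a b) :=
  pint_meas hr (tri a b) (fun p ω => B p.2 ω - B p.1 ω) (fun p => (hB.meas _).sub (hB.meas _)) (cont_diff hB)

theorem bt_nonneg (hr : Good r M) (a b : ℝ) (ω : Ω) : 0 ≤ bt r B a b ω := pint_nonneg hr _ _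

theorem bt_le (hr : Good r M) (a b : ℝ) (h : a ≤ b) (ω : Ω) : bt r B a b ω ≤ M * ((b - a) * (b - a)) :=
  (pint_le hr (vol_tri_top a b) _).trans (mul_le_mul_of_nonneg_left (vol_tri a b h) hr.M_nonneg)

theorem tri_split {a m b : ℝ} (h1 : a ≤ m) (h2 : m ≤ b) :
    tri a b = (tri a m ∪ tri m b) ∪ (Ico a m ×ˢ Ioc m b) := by
  ext ⟨x, y⟩
  simp only [tri, mem_ofPred_eq, mem_union, mem_prod, mem_Ico, mem_Ioc]
  constructor
  · rintro ⟨h3, h4, h5⟩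
    by_cases h6 : y ≤ m
    · exact Or.inl (Or.inl ⟨h3, h4, h6⟩)
    · by_cases h7 : m ≤ x
      · exact Or.inl (Or.inr ⟨h7, h4, h5⟩)
      · exact Or.inr ⟨⟨h3, not_le.1 h7⟩, not_le.1 h6, h5⟩
  · rintro ((⟨h3, h4, h5⟩ | ⟨h3, h4, h5⟩) | ⟨⟨h3, h4⟩, h5, h6⟩) <;> refine ⟨?_, ?_, ?_⟩ <;> linarith

theorem sq_change (hB : IsStdBM P B) {a T : ℝ} (ha : 0 ≤ a) (ω : Ω) :
    ∫ p in Ico a (a + T) ×ˢ Ioc (a + T) (a + 2 * T), r (B p.2 ω - B p.1 ω) =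
      sqf r (fw B (a + T)) (bw B (a + T)) T ω := by
  set m := a + T with hm
  let e : ℝ × ℝ ≃ᵐ ℝ × ℝ := MeasurableEquiv.prodCongr (MeasurableEquiv.subLeft m) (MeasurableEquiv.addLeft m)
  have he : MeasurePreserving e volume volume := by
    have := (Measure.measurePreserving_sub_left (volume : Measure ℝ) m).prod (measurePreserving_add_left (volume : Measure ℝ) m)
    exact this
  have h1 := he.setIntegral_preimage_emb e.measurableEmbedding (fun p => r (B p.2 ω - B p.1 ω)) (Ico a m ×ˢ Ioc m (a + 2 * T))
  rw [← h1]
  have h2 : e ⁻¹' (Ico a m ×ˢ Ioc m (a + 2 * T)) = Ioc 0 T ×ˢ Ioc 0 T := by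
    ext ⟨x, y⟩
    change (a ≤ m - x ∧ m - x < m) ∧ (m < m + y ∧ m + y ≤ a + 2 * T) ↔ (0 < x ∧ x ≤ T) ∧ (0 < y ∧ y ≤ T)
    rw [hm]
    constructor <;> rintro ⟨⟨h1, h2⟩, h3, h4⟩ <;> refine ⟨⟨?_, ?_⟩, ?_, ?_⟩ <;> linarith
  rw [h2, sqf]
  have h3 : (Ioc 0 T ×ˢ Ioc 0 T : Set (ℝ × ℝ)) =ᵐ[volume] (Icc 0 T ×ˢ Icc 0 T : Set (ℝ × ℝ)) := 
    Measure.set_prod_ae_eq Ioc_ae_eq_Icc Ioc_ae_eq_Icc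
  rw [setIntegral_congr_set h3]
  refine setIntegral_congr_fun (measurableSet_Icc.prod measurableSet_Icc) ?_
  rintro ⟨x, y⟩ ⟨⟨h4, h5⟩, h6, h7⟩
  simp only at h4 h5 h6 h7
  change r (B (m + y) ω - B (m - x) ω) = r (fw B m y ω + bw B m x ω)
  have h8 : x ≤ m := by linarith
  simp [fw, bw, max_eq_left h6, min_eq_left h8, max_eq_right h4]

theorem bt_split (hr : Good r M) (hB : IsStdBM P B) {a T : ℝ} (ha : 0 ≤ a) (hT : 0 ≤ T) (ω : Ω) :
    bt r B a (a + 2 * T) ω = bt r B a (a + T) ω + bt r B (a + T) (a + 2 * T) ω +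
      sqf r (fw B (a + T)) (bw B (a + T)) T ω := by
  have hi : IntegrableOn (fun p : ℝ × ℝ => r (B p.2 ω - B p.1 ω)) (tri a (a + 2 * T)) :=
    pint_int hr (vol_tri_top _ _) _ (cont_diff hB ω)
  rw [← sq_change hB ha]
  have hs := tri_split (show a ≤ a + T by linarith) (show a + T ≤ a + 2 * T by linarith)
  rw [bt, hs, setIntegral_union, setIntegral_union]
  · rfl
  · rw [Set.disjoint_left]
    rintro ⟨x, y⟩ ⟨h1, h2, h3⟩ ⟨h4, h5, h6⟩
    simp only at *
    linarith
  · exact meas_tri _ _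
  · exact hi.mono_set (hs ▸ subset_union_left.trans subset_union_left)
  · exact hi.mono_set (hs ▸ subset_union_right.trans subset_union_left)
  · rw [Set.disjoint_left]
    rintro ⟨x, y⟩ (⟨h1, h2, h3⟩ | ⟨h1, h2, h3⟩) ⟨⟨h4, h5⟩, h6, h7⟩ <;> simp only at * <;> linarith
  · exact measurableSet_Ico.prod measurableSet_Ioc
  · exact hi.mono_set (hs ▸ subset_union_left)
  · exact hi.mono_set (hs ▸ subset_union_right)

theorem bt_indep (hr : Good r M) (hB : IsStdBM P B) {a m b : ℝ} (ha : 0 ≤ a) (hm : a ≤ m) :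
    IndepFun (bt r B m b) (bt r B a m) P := by
  have hm0 : 0 ≤ m := ha.trans hm
  have h := fwbw_indep hB hm0
  have c1 : ∀ (p : ℝ × ℝ), p ∈ tri m b → ∀ ω, B p.2 ω - B p.1 ω = fw B m (p.2 - m) ω - fw B m (p.1 - m) ω := by
    rintro ⟨x, y⟩ ⟨h1, h2, h3⟩ ω
    simp only at *
    simp [fw, max_eq_left (sub_nonneg.2 h1), max_eq_left (sub_nonneg.2 (h1.trans h2.le))]
  have c2 : ∀ (p : ℝ × ℝ), p ∈ tri a m → ∀ ω, B p.2 ω - B p.1 ω = bw B m (m - p.1) ω - bw B m (m - p.2) ω := by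
    rintro ⟨x, y⟩ ⟨h1, h2, h3⟩ ω
    simp only at *
    have g1 : 0 ≤ m - y := by linarith
    have g2 : 0 ≤ m - x := by linarith
    have g3 : m - y ≤ m := by linarith
    have g4 : m - x ≤ m := by linarith
    simp [bw, max_eq_right g1, max_eq_right g2, min_eq_left g3, min_eq_left g4]
  have e1 : bt r B m b = fun ω => ∫ p in tri m b, r (fw B m (p.2 - m) ω - fw B m (p.1 - m) ω) := by
    funext ω
    exact setIntegral_congr_fun (meas_tri _ _) fun p hp => by simp only [c1 p hp]
  have e2 : bt r B a m = fun ω => ∫ p in tri a m, r (bw B m (m - p.1) ω - bw B m (m - p.2) ω) := by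
    funext ω
    exact setIntegral_congr_fun (meas_tri _ _) fun p hp => by simp only [c2 p hp]
  have F := fw_incr hB hm0 0
  have G := bw_incr hB hm0 hm0
  have key : ∀ (U : ℝ → Ω → Fin 2 → ℝ) (t : ℝ), Measurable[MeasurableSpace.comap (fun ω (p : ℝ × Fin 2) => U p.1 ω p.2) MeasurableSpace.pi] (U t) := by
    intro U t
    have := (comap_measurable (m := MeasurableSpace.pi) (fun ω (p : ℝ × Fin 2) => U p.1 ω p.2))
    have g : Measurable fun (x : ℝ × Fin 2 → ℝ) (i : Fin 2) => x (t, i) := by fun_prop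
    exact g.comp this
  refine indep_of_indep_of_le_left (indep_of_indep_of_le_right h ?_) ?_
  · rw [e2]
    refine Measurable.comap_le (pint_meas (mΩ := _) hr (tri a m) _ (fun p => ?_) ?_)
    · exact (key (bw B m) _).sub (key (bw B m) _)
    · exact fun ω => ((G.cont ω).comp (by fun_prop)).sub ((G.cont ω).comp (by fun_prop))
  · rw [e1]
    refine Measurable.comap_le (pint_meas (mΩ := _) hr (tri m b) _ (fun p => ?_) ?_)
    · exact (key (fw B m) _).sub (key (fw B m) _)
    · exact fun ω => ((F.cont ω).comp (by fun_prop)).sub ((F.cont ω).comp (by fun_prop))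

end


section
variable {r : (Fin 2 → ℝ) → ℝ} {M : ℝ} {Ω : Type*} [mΩ : MeasurableSpace Ω] {P : Measure Ω} {B : ℝ → Ω → Fin 2 → ℝ}

noncomputable def cX (P : Measure Ω) (f : Ω → ℝ) (ω : Ω) : ℝ := f ω - ∫ ω', f ω' ∂P

theorem cX_meas {f : Ω → ℝ} (hf : Measurable f) : Measurable (cX P f) := hf.sub_const _

theorem cX_bdd {f : Ω → ℝ} {D : ℝ} (h0 : ∀ ω, 0 ≤ f ω) (hD : ∀ ω, f ω ≤ D) (ω : Ω) :
    |cX P f ω| ≤ D + |∫ ω', f ω' ∂P| := by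
  unfold cX
  refine (abs_sub _ _).trans ?_
  rw [abs_of_nonneg (h0 ω)]
  linarith [hD ω]

theorem exp_bdd {x C l : ℝ} (hl : 0 ≤ l) (h : |x| ≤ C) : |exp (l * x)| ≤ exp (l * C) := by
  rw [abs_of_pos (exp_pos _)]
  exact exp_le_exp.2 (mul_le_mul_of_nonneg_left ((le_abs_self _).trans h) hl)

theorem sqf_meas (hr : Good r M) {T : ℝ}
    {U V : ℝ → Ω → Fin 2 → ℝ} (hU : Incr P T U) (hV : Incr P T V) : Measurable (sqf r U V T) :=
  pint_meas hr (Icc (0:ℝ) T ×ˢ Icc (0:ℝ) T) (fun p ω => U p.2 ω + V p.1 ω) (fun p => (hU.meas _).add (hV.meas _))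
   fun ω => ((hU.cont ω).comp continuous_snd).add ((hV.cont ω).comp continuous_fst)

def Claim (r : (Fin 2 → ℝ) → ℝ) (P : Measure Ω) (B : ℝ → Ω → Fin 2 → ℝ) (T : ℝ) : Prop :=
  ∀ a l : ℝ, 0 ≤ a → 0 ≤ l → l * T * (3 * KK) ≤ 1 →
    ∫ ω, exp (l * cX P (bt r B a (a + T)) ω) ∂P ≤ exp (6 * KK ^ 2 * l ^ 2 * T ^ 2)

theorem claim_base (hr : Good r M) (hB : IsStdBM P B) {T : ℝ} (hT : 0 < T) (h : M ^ 2 * T ^ 2 ≤ 8 * (6 * KK ^ 2)) :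
    Claim r P B T := by
  intro a l ha hl _
  have := hB.isProb
  have hs := hasSubgaussianMGF_of_mem_Icc (μ := P) (X := bt r B a (a + T)) (a := 0) (b := M * (T * T))
    (bt_meas hr hB _ _).aemeasurable (.of_forall fun ω => ⟨bt_nonneg hr _ _ _, by
      have := bt_le (B := B) hr a (a + T) (by linarith) ω
      rwa [add_sub_cancel_left] at this⟩)
  have h2 := hs.mgf_le l
  unfold mgf at h2
  refine h2.trans (exp_le_exp.2 ?_)
  have hM := hr.M_nonneg
  have e : (((‖M * (T * T) - 0‖₊ / 2) ^ 2 : NNReal) : ℝ) = (M * (T * T) / 2) ^ 2 := by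
    push_cast
    rw [sub_zero, Real.norm_of_nonneg (by positivity)]
  rw [e]
  have := mul_le_mul_of_nonneg_right h (show 0 ≤ l ^ 2 * T ^ 2 / 8 by positivity)
  nlinarith [this]

theorem claim_step (hr : Good r M) (hB : IsStdBM P B) {T : ℝ} (hT : 0 < T) (hc : Claim r P B T) :
    Claim r P B (2 * T) := by
  intro a l ha hl hlT
  have := hB.isProb
  have hK := KK_pos
  have hM := hr.M_nonneg
  set f1 := bt r B a (a + T)
  set f2 := bt r B (a + T) (a + 2 * T)
  set f3 := sqf r (fw B (a + T)) (bw B (a + T)) T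
  have U := fw_incr hB (show 0 ≤ a + T by linarith) T
  have V := bw_incr hB (show 0 ≤ a + T by linarith) (show T ≤ a + T by linarith)
  have I := fwbw_indep hB (show 0 ≤ a + T by linarith)
  have m1 : Measurable f1 := bt_meas hr hB _ _
  have m2 : Measurable f2 := bt_meas hr hB _ _
  have m3 : Measurable f3 := sqf_meas hr U V
  have n1 : ∀ ω, 0 ≤ f1 ω := fun ω => bt_nonneg hr _ _ _
  have n2 : ∀ ω, 0 ≤ f2 ω := fun ω => bt_nonneg hr _ _ _
  have n3 : ∀ ω, 0 ≤ f3 ω := fun ω => pint_nonneg hr _ _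
  obtain ⟨D1, b1⟩ : ∃ D, ∀ ω, f1 ω ≤ D := ⟨_, fun ω => bt_le hr _ _ (by linarith) ω⟩
  obtain ⟨D2, b2⟩ : ∃ D, ∀ ω, f2 ω ≤ D := ⟨_, fun ω => bt_le hr _ _ (by linarith) ω⟩
  obtain ⟨D3, b3⟩ : ∃ D, ∀ ω, f3 ω ≤ D := ⟨_, fun ω => pint_le hr (vol_sq_top _ _ _ _) _⟩
  have i1 : Integrable f1 P := bdd_int m1 (C := D1) fun ω => by rw [abs_of_nonneg (n1 ω)]; exact b1 ω
  have i2 : Integrable f2 P := bdd_int m2 (C := D2) fun ω => by rw [abs_of_nonneg (n2 ω)]; exact b2 ω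
  have i3 : Integrable f3 P := bdd_int m3 (C := D3) fun ω => by rw [abs_of_nonneg (n3 ω)]; exact b3 ω
  have hsum : bt r B a (a + 2 * T) = fun ω => f1 ω + f2 ω + f3 ω := by
    funext ω; exact bt_split hr hB ha hT.le ω
  have hcX : ∀ ω, cX P (bt r B a (a + 2 * T)) ω = cX P f1 ω + cX P f2 ω + cX P f3 ω := by
    intro ω
    rw [hsum]
    unfold cX
    have q1 : ∫ ω', (f1 ω' + f2 ω' + f3 ω') ∂P = ∫ ω', (f1 ω' + f2 ω') ∂P + ∫ ω', f3 ω' ∂P := integral_add (i1.add i2) i3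
    have q2 : ∫ ω', (f1 ω' + f2 ω') ∂P = ∫ ω', f1 ω' ∂P + ∫ ω', f2 ω' ∂P := integral_add i1 i2
    simp only [q1, q2]
    ring
  have g1 := cX_bdd (P := P) n1 b1
  have g2 := cX_bdd (P := P) n2 b2
  have g3 := cX_bdd (P := P) n3 b3
  have k1 := cX_meas (P := P) m1
  have k2 := cX_meas (P := P) m2
  have k3 := cX_meas (P := P) m3
  -- first piece
  have hE1 : ∫ ω, exp (3 / 2 * l * (cX P f1 ω + cX P f2 ω)) ∂P ≤ exp (27 * KK ^ 2 * l ^ 2 * T ^ 2) := by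
    have hind : IndepFun (fun ω => exp (3 / 2 * l * cX P f2 ω)) (fun ω => exp (3 / 2 * l * cX P f1 ω)) P := by
      have := bt_indep (b := a + 2 * T) hr hB ha (show a ≤ a + T by linarith)
      exact this.comp (φ := fun x => exp (3 / 2 * l * (x - ∫ ω', f2 ω' ∂P))) (ψ := fun x => exp (3 / 2 * l * (x - ∫ ω', f1 ω' ∂P)))
        (by fun_prop) (by fun_prop)
    have hmul := hind.integral_fun_mul_eq_mul_integral ((k2.const_mul _).exp.aestronglyMeasurable) ((k1.const_mul _).exp.aestronglyMeasurable)
    have e : ∀ ω, exp (3 / 2 * l * (cX P f1 ω + cX P f2 ω)) = exp (3 / 2 * l * cX P f2 ω) * exp (3 / 2 * l * cX P f1 ω) := by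
      intro ω; rw [← Real.exp_add]; congr 1; ring
    simp only [e]
    rw [hmul]
    have hlT' : 3 / 2 * l * T * (3 * KK) ≤ 1 := by
      have : 0 ≤ l * T * KK := by positivity
      nlinarith
    have q1 := hc a (3 / 2 * l) ha (by positivity) hlT'
    have q2 := hc (a + T) (3 / 2 * l) (by linarith) (by positivity) hlT'
    rw [show a + T + T = a + 2 * T by ring] at q2
    calc _ ≤ exp (6 * KK ^ 2 * (3 / 2 * l) ^ 2 * T ^ 2) * exp (6 * KK ^ 2 * (3 / 2 * l) ^ 2 * T ^ 2) :=
          mul_le_mul q2 q1 (integral_nonneg fun ω => (exp_pos _).le) (exp_pos _).le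
      _ = _ := by rw [← Real.exp_add]; congr 1; ring
  have hE2 : ∫ ω, exp (3 * l * cX P f3 ω) ∂P ≤ exp (18 * KK ^ 2 * l ^ 2 * T ^ 2) := by
    have := exp_two m3 n3 b3 (K := KK * T) (by positivity) (sq_moment hr hT U V I) (l := 3 * l) (by positivity) (by nlinarith)
    refine this.trans (le_of_eq ?_)
    congr 1; ring
  have hpq : (3 / 2 : ℝ).HolderConjugate 3 := by
    rw [Real.holderConjugate_iff]; norm_num
  have hH := integral_mul_le_Lp_mul_Lq_of_nonneg (μ := P) hpq
    (f := fun ω => exp (l * (cX P f1 ω + cX P f2 ω))) (g := fun ω => exp (l * cX P f3 ω))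
    (.of_forall fun ω => (exp_pos _).le) (.of_forall fun ω => (exp_pos _).le)
    (MemLp.of_bound (((k1.add k2).const_mul _).exp.aestronglyMeasurable) _
      (.of_forall fun ω => exp_bdd hl ((abs_add_le _ _).trans (add_le_add (g1 ω) (g2 ω)))))
    (MemLp.of_bound ((k3.const_mul _).exp.aestronglyMeasurable) _
      (.of_forall fun ω => exp_bdd hl (g3 ω)))
  have e1 : ∀ ω, exp (l * (cX P f1 ω + cX P f2 ω)) ^ (3 / 2 : ℝ) = exp (3 / 2 * l * (cX P f1 ω + cX P f2 ω)) := by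
    intro ω; rw [← Real.exp_mul]; congr 1; ring
  have e2 : ∀ ω, exp (l * cX P f3 ω) ^ (3 : ℝ) = exp (3 * l * cX P f3 ω) := by
    intro ω; rw [← Real.exp_mul]; congr 1; ring
  simp only [e1, e2] at hH
  have e3 : ∀ ω, exp (l * cX P (bt r B a (a + 2 * T)) ω) = exp (l * (cX P f1 ω + cX P f2 ω)) * exp (l * cX P f3 ω) := by
    intro ω; rw [hcX, ← Real.exp_add]; congr 1; ring
  simp only [e3]
  refine hH.trans ?_
  calc _ ≤ exp (27 * KK ^ 2 * l ^ 2 * T ^ 2) ^ (1 / (3 / 2) : ℝ) * exp (18 * KK ^ 2 * l ^ 2 * T ^ 2) ^ (1 / 3 : ℝ) := by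
        have z1 : 0 ≤ ∫ ω, exp (3 / 2 * l * (cX P f1 ω + cX P f2 ω)) ∂P := integral_nonneg fun ω => (exp_pos _).le
        have z2 : 0 ≤ ∫ ω, exp (3 * l * cX P f3 ω) ∂P := integral_nonneg fun ω => (exp_pos _).le
        exact mul_le_mul (rpow_le_rpow z1 hE1 (by norm_num)) (rpow_le_rpow z2 hE2 (by norm_num))
          (rpow_nonneg z2 _) (by positivity)
    _ = _ := by
        rw [← Real.exp_mul, ← Real.exp_mul, ← Real.exp_add]; congr 1; ring

theorem claim_one (hr : Good r M) (hB : IsStdBM P B) : Claim r P B 1 := by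
  have hM := hr.M_nonneg
  have hK := KK_pos
  obtain ⟨N, hN⟩ : ∃ N : ℕ, M ^ 2 * ((1 / 2 : ℝ) ^ N) ^ 2 ≤ 8 * (6 * KK ^ 2) := by
    have h0 : Tendsto (fun N : ℕ => M ^ 2 * ((1 / 2 : ℝ) ^ N) ^ 2) atTop (nhds (M ^ 2 * 0 ^ 2)) :=
      ((tendsto_pow_atTop_nhds_zero_of_lt_one (by norm_num) (by norm_num)).pow 2).const_mul _
    have h1 : M ^ 2 * 0 ^ 2 < 8 * (6 * KK ^ 2) := by
      have : 0 < KK ^ 2 := by positivity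
      linarith
    obtain ⟨N, hN⟩ := (h0.eventually (gt_mem_nhds h1)).exists
    exact ⟨N, hN.le⟩
  have hj : ∀ j : ℕ, Claim r P B (2 ^ j * (1 / 2 : ℝ) ^ N) := by
    intro j
    induction j with
    | zero => simpa using claim_base hr hB (T := (1 / 2 : ℝ) ^ N) (by positivity) hN
    | succ j ih =>
      have := claim_step hr hB (by positivity) ih
      rwa [← mul_assoc, ← pow_succ'] at this
  have := hj N
  rwa [← mul_pow, show (2 * (1 / 2) : ℝ) = 1 by norm_num, one_pow] at this

end


theorem good_R {ρ R : (Fin 2 → ℝ) → ℝ} (hc : Continuous ρ) (h0 : ∀ x, 0 ≤ ρ x) (hs : HasCompactSupport ρ)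
    (h1 : (∫ x : Fin 2 → ℝ, ρ x) = 1) (hR : ∀ x, R x = ∫ y : Fin 2 → ℝ, ρ (x - y) * ρ y)
    {ε : ℝ} (hε : 0 < ε) : ∃ M, Good (mollify R ε) M := by
  have hi : Integrable ρ := hc.integrable_of_hasCompactSupport hs
  have hRc : R = convolution ρ ρ (ContinuousLinearMap.mul ℝ ℝ) volume := by
    funext x
    rw [hR, convolution_def]
    simp only [ContinuousLinearMap.mul_apply', mul_comm]
  have cR : Continuous R := by
    rw [hRc]
    exact hs.continuous_convolution_right _ hi.locallyIntegrable hc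
  have iR : Integrable R := by
    rw [hRc]
    exact hi.integrable_convolution _ hi
  have intR : ∫ x, R x = 1 := by
    rw [hRc, integral_convolution _ hi hi]
    simp [h1]
  have R0 : ∀ x, 0 ≤ R x := fun x => by
    rw [hR]; exact integral_nonneg fun y => mul_nonneg (h0 _) (h0 _)
  obtain ⟨D, hD⟩ := hs.exists_bound_of_continuous hc
  have hD' : ∀ x, ρ x ≤ D := fun x => (le_abs_self _).trans (hD x)
  have hRD : ∀ x, R x ≤ D := by
    intro x
    rw [hR]
    calc ∫ y : Fin 2 → ℝ, ρ (x - y) * ρ y ≤ ∫ y : Fin 2 → ℝ, D * ρ y :=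
          integral_mono_of_nonneg (.of_forall fun y => mul_nonneg (h0 _) (h0 _)) (hi.const_mul D)
            (.of_forall fun y => mul_le_mul_of_nonneg_right (hD' _) (h0 _))
      _ = D := by rw [integral_const_mul, h1, mul_one]
  have hz : ∀ x, 0 ≤ mollify R ε x := fun x => mul_nonneg (by positivity) (R0 _)
  refine ⟨(ε ^ 2)⁻¹ * D, ?_, hz, fun x => mul_le_mul_of_nonneg_left (hRD _) (by positivity), ?_⟩
  · exact continuous_const.mul (cR.comp (continuous_const_smul _))
  · have i2 : Integrable (mollify R ε) := (iR.comp_smul (inv_ne_zero hε.ne')).const_mul _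
    rw [← ofReal_integral_eq_lintegral_ofReal i2 (.of_forall hz)]
    unfold mollify
    rw [integral_const_mul, Measure.integral_comp_smul, intR]
    simp only [Module.finrank_fintype_fun_eq_card, Fintype.card_fin, inv_pow, inv_inv, smul_eq_mul, mul_one]
    rw [abs_of_pos (by positivity), inv_mul_cancel₀ (by positivity)]
    simp

theorem alpha_eq {Ω : Type*} [MeasurableSpace Ω] {P : Measure Ω} {R : (Fin 2 → ℝ) → ℝ} {ε : ℝ} {B₁ B₂ : ℝ → Ω → Fin 2 → ℝ}
    (h1 : IsStdBM P B₁) (h2 : IsStdBM P B₂) (ω : Ω) :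
    alphaSet R ε B₁ B₂ (Set.Icc 0 1 ×ˢ Set.Icc 0 1) ω = sqf (mollify R ε) (fw B₁ 0) (ng B₂) 1 ω := by
  refine setIntegral_congr_fun (measurableSet_Icc.prod measurableSet_Icc) ?_
  rintro ⟨x, y⟩ ⟨⟨h4, h5⟩, h6, h7⟩
  simp only at h4 h5 h6 h7
  simp [fw, ng, max_eq_left h4, max_eq_left h6, h1.init, h2.init, sub_eq_add_neg]

theorem to_lint {Ω : Type*} [MeasurableSpace Ω] {P : Measure Ω} [IsProbabilityMeasure P] {f : Ω → ℝ} (hf : Measurable f)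
    {l C D : ℝ} (hl : 0 ≤ l) (hD : ∀ ω, |f ω| ≤ D) (h : ∫ ω, exp (l * f ω) ∂P ≤ C) :
    ∫⁻ ω, ENNReal.ofReal (exp (l * f ω)) ∂P ≤ ENNReal.ofReal C := by
  rw [← ofReal_integral_eq_lintegral_ofReal (bdd_int (hf.const_mul l).exp fun ω => exp_bdd hl (hD ω)) (.of_forall fun ω => (exp_pos _).le)]
  exact ENNReal.ofReal_le_ofReal h

theorem stmt_9 :
    ∃ lam C : ℝ, 0 < lam ∧ 0 < C ∧
      ∀ (ρ R : (Fin 2 → ℝ) → ℝ), Continuous ρ → (∀ x, 0 ≤ ρ x) → (∀ x, ρ (-x) = ρ x) →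
        HasCompactSupport ρ → (∫ x : Fin 2 → ℝ, ρ x) = 1 →
        (∀ x, R x = ∫ y : Fin 2 → ℝ, ρ (x - y) * ρ y) →
        ∀ (Ω : Type*) [MeasurableSpace Ω] (P : Measure Ω)
          (W : ℝ → Ω → (Fin 3 × Fin 2) → ℝ), IsStdBM P W →
          ∀ ε : ℝ, ε ∈ Set.Ioo (0:ℝ) 1 →
            (∫⁻ ω, ENNReal.ofReal (Real.exp (lam *
                (betaSet R ε (planarComp W 0) (ltSet 1) ω
                  - ∫ ω', betaSet R ε (planarComp W 0) (ltSet 1) ω' ∂P))) ∂P)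
            + (∫⁻ ω, ENNReal.ofReal (Real.exp (lam *
                alphaSet R ε (planarComp W 1) (planarComp W 2)
                  (Set.Icc 0 1 ×ˢ Set.Icc 0 1) ω)) ∂P)
            ≤ ENNReal.ofReal C := by
  have hK := KK_pos
  refine ⟨1 / (3 * KK), exp (6 * KK ^ 2 * (1 / (3 * KK)) ^ 2 * 1 ^ 2) + 2, by positivity, by positivity, ?_⟩
  intro ρ R hc h0 _ hs h1 hR Ω _ P W hW ε hε
  have := hW.isProb
  have hl : 0 ≤ 1 / (3 * KK) := by positivity
  set l := 1 / (3 * KK) with hldef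
  have hlK : l * KK = 1 / 3 := by rw [hldef]; field_simp
  obtain ⟨M, hr⟩ := good_R hc h0 hs h1 hR hε.1
  have B0 := bm_planar hW 0
  have B1 := bm_planar hW 1
  have B2 := bm_planar hW 2
  rw [ENNReal.ofReal_add (exp_pos _).le (by norm_num)]
  refine add_le_add ?_ ?_
  · have e : betaSet R ε (planarComp W 0) (ltSet 1) = bt (mollify R ε) (planarComp W 0) 0 (0 + 1) := by
      rw [zero_add]; rfl
    have h := claim_one hr B0 0 l le_rfl hl (by linarith)
    rw [e]
    exact to_lint (cX_meas (bt_meas hr B0 _ _)) hl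
      (cX_bdd (P := P) (bt_nonneg hr _ _) (bt_le hr _ _ (by norm_num))) h
  · simp only [alpha_eq B1 B2]
    have U := fw_incr B1 le_rfl 1
    have V := ng_incr B2 1
    have I := alpha_indep hW (show (1 : Fin 3) ≠ 2 by decide)
    have m3 := sqf_meas hr U V
    have n3 : ∀ ω, 0 ≤ sqf (mollify R ε) (fw (planarComp W 1) 0) (ng (planarComp W 2)) 1 ω := fun ω => pint_nonneg hr _ _
    have b3 : ∀ ω, sqf (mollify R ε) (fw (planarComp W 1) 0) (ng (planarComp W 2)) 1 ω ≤ _ := fun ω => pint_le hr (vol_sq_top _ _ _ _) _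
    refine to_lint (D := M * volume.real (Icc (0:ℝ) 1 ×ˢ Icc (0:ℝ) 1)) m3 hl (fun ω => ?_) (exp_one m3 n3 b3 (K := KK * 1) (by positivity) (sq_moment hr one_pos U V I) hl (by linarith))
    rw [abs_of_nonneg (n3 ω)]; exact b3 ω
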